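/- arXiv:1509.07803 — 2 statements merged into one kernel-verified Lean document; each statement's English description precedes it below -/
import Mathlib

section
/- Let p ≥ 2 be a prime number and let q ≥ 3 be an integer with gcd(p, q) = 1. Let K = ℂ(t) be the field of rational functions over ℂ, and for an integer j ≥ 1 let Y_j = K[x,y]/(t^j(x^p + y^q) − 1), the coordinate ring of the curve {x^p + y^q = t^{−j}} in 𝔸²_K. If Y_ℓ and Y_{ℓ'} are isomorphic as K-algebras for some integers ℓ, ℓ' ≥ 1, then ℓ ≡ ℓ' (mod q). -/
/-- `Y_j = K[x,y]/(t^j(x^p + y^q) - 1)` over `K = ℂ(t)`, the coordinate ring of the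
smooth affine curve `{x^p + y^q = t^{-j}}` in `𝔸²_K`. -/
noncomputable abbrev curveRingPQ (p q j : ℕ) : Type :=
  MvPolynomial (Fin 2) (RatFunc ℂ) ⧸ Ideal.span
    {MvPolynomial.C ((RatFunc.X : RatFunc ℂ) ^ j) *
      ((MvPolynomial.X 0 : MvPolynomial (Fin 2) (RatFunc ℂ)) ^ p +
        (MvPolynomial.X 1) ^ q) - 1}

theorem AddValuation.exists_map_sum_eq {R ι : Type*} [Ring R] (v : AddValuation R (WithTop ℤ))
    {s : Finset ι} (hs : s.Nonempty) {f : ι → R} (hf : ∀ i ∈ s, v (f i) ≠ ⊤)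
    (hinj : Set.InjOn (fun i ↦ v (f i)) s) :
    ∃ i ∈ s, v (∑ j ∈ s, f j) = v (f i) ∧ ∀ j ∈ s, v (f i) ≤ v (f j) := by
  classical
  obtain ⟨i, hi, hmin⟩ := s.exists_min_image (fun i ↦ v (f i)) hs
  refine ⟨i, hi, ?_, hmin⟩
  rw [← Finset.add_sum_erase s f hi]
  refine v.map_add_eq_of_lt_left (v.map_lt_sum (hf i hi) fun j hj ↦ ?_)
  have hj' := Finset.mem_of_mem_erase hj
  exact lt_of_le_of_ne (hmin j hj') fun h ↦ Finset.ne_of_mem_erase hj (hinj hj' hi h.symm)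

/-- Evaluation of a bivariate polynomial, sending the outer variable to `x` and the inner one
to `y`. -/
noncomputable def Polynomial.evalPair {K A : Type*} [Field K] [CommRing A] [Algebra K A]
    (x y : A) : Polynomial (Polynomial K) →ₐ[K] A :=
  aevalAeval y x

theorem Polynomial.evalPair_C {K A : Type*} [Field K] [CommRing A] [Algebra K A]
    (x y : A) (f : Polynomial K) : evalPair x y (C f) = aeval y f :=
  aevalAeval_C y x f

theorem Polynomial.evalPair_X {K A : Type*} [Field K] [CommRing A] [Algebra K A]
    (x y : A) : evalPair x y (X : Polynomial (Polynomial K)) = x :=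
  aevalAeval_Y y x

theorem Polynomial.evalPair_eq_sum_sigma {K A : Type*} [Field K] [CommRing A] [Algebra K A]
    (x y : A) (P : Polynomial (Polynomial K)) :
    evalPair x y P = ∑ s ∈ P.support.sigma fun i ↦ (P.coeff i).support,
      algebraMap K A ((P.coeff s.1).coeff s.2) * y ^ s.2 * x ^ s.1 := by
  rw [Finset.sum_sigma]
  conv_lhs => rw [P.as_sum_support_C_mul_X_pow]
  rw [map_sum]
  refine Finset.sum_congr rfl fun i _ ↦ ?_
  rw [map_mul, map_pow, evalPair_C, evalPair_X, Polynomial.aeval_def, Polynomial.eval₂_eq_sum,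
    Polynomial.sum_def, Finset.sum_mul]

theorem monomial_weight_injective {p q : ℕ} (hpq : p.Coprime q) {i i' j j' : ℕ}
    (hi : i < p) (hi' : i' < p) (h : q * i + p * j = q * i' + p * j') : i = i' ∧ j = j' := by
  have hmod : i ≡ i' [MOD p] := by
    refine Nat.ModEq.cancel_left_of_coprime hpq ?_
    have : (q * i + p * j) % p = (q * i' + p * j') % p := by rw [h]
    simpa [Nat.ModEq] using this
  have hii : i = i' := by rwa [Nat.ModEq, Nat.mod_eq_of_lt hi, Nat.mod_eq_of_lt hi'] at hmod
  subst hii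
  exact ⟨rfl, Nat.eq_of_mul_eq_mul_left (by lia) (Nat.add_left_cancel h)⟩

theorem AddValuation.exists_map_evalPair_eq {K A : Type*} [Field K] [CommRing A] [Algebra K A]
    (v : AddValuation A (WithTop ℤ)) (hv : ∀ r : K, r ≠ 0 → v (algebraMap K A r) = 0)
    {p q : ℕ} (hpq : p.Coprime q) {x y : A} {m : ℤ} (hm : 0 < m)
    (hx : v x = ((-(m * q) : ℤ) : WithTop ℤ)) (hy : v y = ((-(m * p) : ℤ) : WithTop ℤ))
    {P : Polynomial (Polynomial K)} (hP : P ≠ 0) (hdeg : P.natDegree < p) :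
    ∃ i j, (P.coeff i).coeff j ≠ 0 ∧
      v (Polynomial.evalPair x y P) = ((-(m * (q * i + p * j : ℕ)) : ℤ) : WithTop ℤ) ∧
      ∀ i' j', (P.coeff i').coeff j' ≠ 0 → q * i' + p * j' ≤ q * i + p * j := by
  have hval : ∀ i j, (P.coeff i).coeff j ≠ 0 →
      v (algebraMap K A ((P.coeff i).coeff j) * y ^ j * x ^ i) =
        ((-(m * (q * i + p * j : ℕ)) : ℤ) : WithTop ℤ) := by
    intro i j hij
    rw [v.map_mul, v.map_mul, v.map_pow, v.map_pow, hv _ hij, hx, hy, ← WithTop.coe_nsmul,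
      ← WithTop.coe_nsmul, zero_add, ← WithTop.coe_add]
    congr 1
    simp only [nsmul_eq_mul]
    push_cast
    ring
  have hmem : ∀ i j, (P.coeff i).coeff j ≠ 0 →
      (⟨i, j⟩ : Σ _ : ℕ, ℕ) ∈ P.support.sigma fun i ↦ (P.coeff i).support := by
    intro i j hij
    simp only [Finset.mem_sigma, Polynomial.mem_support_iff]
    exact ⟨fun h ↦ hij (by simp [h]), hij⟩
  obtain ⟨⟨i, j⟩, hij, hsum, hmin⟩ := v.exists_map_sum_eq
    (s := P.support.sigma fun i ↦ (P.coeff i).support)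
    (f := fun s ↦ algebraMap K A ((P.coeff s.1).coeff s.2) * y ^ s.2 * x ^ s.1)
    ⟨⟨P.natDegree, P.leadingCoeff.natDegree⟩, hmem _ _ (by simpa using hP)⟩ (by
      rintro ⟨i, j⟩ hij
      simp only [Finset.mem_sigma, Polynomial.mem_support_iff] at hij
      rw [hval i j hij.2]
      exact WithTop.coe_ne_top) (by
      rintro ⟨i, j⟩ hij ⟨i', j'⟩ hij' h
      simp only [Finset.coe_sigma, Set.mem_sigma_iff, Finset.mem_coe,
        Polynomial.mem_support_iff] at hij hij'
      simp only [hval i j hij.2, hval i' j' hij'.2, WithTop.coe_inj, neg_inj] at h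
      have h' := mul_left_cancel₀ hm.ne' h
      obtain ⟨rfl, rfl⟩ := monomial_weight_injective hpq
        ((Polynomial.le_natDegree_of_ne_zero hij.1).trans_lt hdeg)
        ((Polynomial.le_natDegree_of_ne_zero hij'.1).trans_lt hdeg) (by exact_mod_cast h')
      rfl)
  have hij' : (P.coeff i).coeff j ≠ 0 := by
    simp only [Finset.mem_sigma, Polynomial.mem_support_iff] at hij
    exact hij.2
  refine ⟨i, j, hij', ?_, fun i' j' h ↦ ?_⟩
  · rw [Polynomial.evalPair_eq_sum_sigma, hsum, hval i j hij']
  · have := hmin _ (hmem _ _ h)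
    simp only [hval i j hij', hval i' j' h, WithTop.coe_le_coe, neg_le_neg_iff] at this
    exact_mod_cast le_of_mul_le_mul_left this hm

/-- Every element of an algebra generated by `x, y` with `x ^ p + y ^ q` constant is a polynomial
in `x, y` of degree less than `p` in `x`. -/
theorem exists_evalPair_eq_of_adjoin_eq_top {K A : Type*} [Field K] [CommRing A] [Algebra K A]
    {p q : ℕ} (hp : p ≠ 0) {x y : A} {c : K} (hxy : x ^ p + y ^ q = algebraMap K A c)
    (hgen : Algebra.adjoin K {x, y} = ⊤) (a : A) :
    ∃ P : Polynomial (Polynomial K), P.natDegree < p ∧ Polynomial.evalPair x y P = a := by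
  have hle : Algebra.adjoin K {x, y} ≤ (Polynomial.evalPair (K := K) x y).range := by
    rw [Algebra.adjoin_le_iff]
    rintro z (rfl | rfl : z = x ∨ z = y)
    · exact ⟨Polynomial.X, Polynomial.evalPair_X _ _⟩
    · exact ⟨Polynomial.C Polynomial.X, by simp [Polynomial.evalPair_C]⟩
  obtain ⟨Q, rfl⟩ := hle (hgen ▸ Algebra.mem_top : a ∈ Algebra.adjoin K {x, y})
  let F : Polynomial (Polynomial K) :=
    Polynomial.X ^ p + Polynomial.C (Polynomial.X ^ q - Polynomial.C c)
  have hF : F.Monic := Polynomial.monic_X_pow_add_C _ hp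
  have hFdeg : F.natDegree = p := Polynomial.natDegree_X_pow_add_C
  have hF0 : Polynomial.evalPair x y F = 0 := by
    simp only [F, map_add, map_pow, Polynomial.evalPair_X, Polynomial.evalPair_C, map_sub,
      Polynomial.aeval_X, Polynomial.aeval_C]
    rw [← hxy]
    ring
  refine ⟨Q %ₘ F, ?_, ?_⟩
  · rw [← hFdeg]
    exact Polynomial.natDegree_modByMonic_lt _ hF fun h ↦ hp (by rw [← hFdeg, h]; simp)
  · conv_rhs => rw [← Polynomial.modByMonic_add_div Q F]
    simp [hF0]

/-- A valuation that is trivial on constants and negative on `y` takes values in ratio `q : p` on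
`x, y` as soon as `x ^ p + y ^ q` is constant. -/
theorem AddValuation.exists_eq_neg_mul_of_pow_add_pow_eq {K A : Type*} [Field K] [CommRing A]
    [Algebra K A] (v : AddValuation A (WithTop ℤ))
    (hv : ∀ r : K, r ≠ 0 → v (algebraMap K A r) = 0)
    {p q : ℕ} (hp : p ≠ 0) (hq : q ≠ 0) (hpq : p.Coprime q) {x y : A} {c : K}
    (hxy : x ^ p + y ^ q = algebraMap K A c) (hneg : v y < 0) :
    ∃ m : ℤ, 0 < m ∧ v x = ((-(m * q) : ℤ) : WithTop ℤ) ∧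
      v y = ((-(m * p) : ℤ) : WithTop ℤ) := by
  have hc : 0 ≤ v (algebraMap K A c) := by
    rcases eq_or_ne c 0 with rfl | h
    · simp
    · exact (hv c h).ge
  obtain ⟨b, hb⟩ := WithTop.ne_top_iff_exists.mp (ne_top_of_lt hneg)
  rw [← hb] at hneg ⊢
  have hb0 : b < 0 := by exact_mod_cast hneg
  have hyq : v (y ^ q) = ((q * b : ℤ) : WithTop ℤ) := by
    rw [v.map_pow, ← hb, ← WithTop.coe_nsmul, nsmul_eq_mul]
  have hxp : v (x ^ p) = ((q * b : ℤ) : WithTop ℤ) := by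
    rw [eq_sub_of_add_eq hxy, ← hyq]
    refine v.map_sub_eq_of_lt_right (lt_of_lt_of_le ?_ hc)
    rw [hyq, ← WithTop.coe_zero, WithTop.coe_lt_coe]
    exact mul_neg_of_pos_of_neg (by positivity) hb0
  have hxtop : v x ≠ ⊤ := fun h ↦ by
    rw [v.map_pow, h] at hxp
    obtain ⟨n, rfl⟩ := Nat.exists_eq_succ_of_ne_zero hp
    rw [succ_nsmul, add_top] at hxp
    exact WithTop.top_ne_coe hxp
  obtain ⟨a, ha⟩ := WithTop.ne_top_iff_exists.mp hxtop
  rw [v.map_pow, ← ha, ← WithTop.coe_nsmul, nsmul_eq_mul, WithTop.coe_inj] at hxp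
  have hdvd : (p : ℤ) ∣ b := by
    refine IsCoprime.dvd_of_dvd_mul_left (Nat.isCoprime_iff_coprime.mpr hpq) ⟨a, hxp.symm⟩
  obtain ⟨k, rfl⟩ := hdvd
  have hp' : (0 : ℤ) < p := by positivity
  refine ⟨-k, by nlinarith, ?_, by congr 1; ring⟩
  rw [← ha]
  congr 1
  refine mul_left_cancel₀ hp'.ne' ?_
  rw [hxp]; ring

theorem AddValuation.lt_zero_or_lt_zero_of_adjoin_eq_top {K A : Type*} [Field K] [CommRing A]
    [Algebra K A] (v : AddValuation A (WithTop ℤ))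
    (hv : ∀ r : K, r ≠ 0 → v (algebraMap K A r) = 0) {x y z : A} (hz : v z < 0)
    (hgen : Algebra.adjoin K {x, y} = ⊤) : v x < 0 ∨ v y < 0 := by
  by_contra! h
  have : ∀ a ∈ Algebra.adjoin K {x, y}, 0 ≤ v a := by
    intro a ha
    induction ha using Algebra.adjoin_induction with
    | mem a ha => rcases ha with rfl | rfl; exacts [h.1, h.2]
    | algebraMap r =>
      rcases eq_or_ne r 0 with rfl | hr
      · simp
      · exact (hv r hr).ge
    | add a b _ _ ha hb => exact v.map_le_add ha hb
    | mul a b _ _ ha hb => rw [v.map_mul]; exact add_nonneg ha hb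
  exact absurd hz (this z (hgen ▸ Algebra.mem_top)).not_gt

theorem AddValuation.generators_eq_of_adjoin_eq_top {K A : Type*} [Field K] [CommRing A]
    [Algebra K A] (v : AddValuation A (WithTop ℤ))
    (hv : ∀ r : K, r ≠ 0 → v (algebraMap K A r) = 0)
    {p q : ℕ} (hp : p ≠ 0) (hq : q ≠ 0) (hpq : p.Coprime q) {x y x' y' : A} {c' : K}
    (hxy' : x' ^ p + y' ^ q = algebraMap K A c') (hgen' : Algebra.adjoin K {x', y'} = ⊤)
    (hx : v x = ((-q : ℤ) : WithTop ℤ)) (hy : v y = ((-p : ℤ) : WithTop ℤ)) :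
    v x' = ((-q : ℤ) : WithTop ℤ) ∧ v y' = ((-p : ℤ) : WithTop ℤ) := by
  have hy0 : v y < 0 := by
    rw [hy, ← WithTop.coe_zero, WithTop.coe_lt_coe]
    lia
  obtain ⟨m, hm, hx', hy'⟩ : ∃ m : ℤ, 0 < m ∧ v x' = ((-(m * q) : ℤ) : WithTop ℤ) ∧
      v y' = ((-(m * p) : ℤ) : WithTop ℤ) := by
    rcases v.lt_zero_or_lt_zero_of_adjoin_eq_top hv hy0 hgen' with h | h
    · obtain ⟨m, hm, h₁, h₂⟩ := v.exists_eq_neg_mul_of_pow_add_pow_eq hv hq hp hpq.symm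
        (by rw [add_comm, hxy']) h
      exact ⟨m, hm, h₂, h₁⟩
    · exact v.exists_eq_neg_mul_of_pow_add_pow_eq hv hp hq hpq hxy' h
  have hdvd : ∀ (z : A) (n : ℕ), n ≠ 0 → v z = ((-n : ℤ) : WithTop ℤ) → m ∣ n := by
    intro z n hn hz
    obtain ⟨P, hP, rfl⟩ := exists_evalPair_eq_of_adjoin_eq_top hp hxy' hgen' z
    have hP0 : P ≠ 0 := by
      rintro rfl
      rw [_root_.map_zero, v.map_zero] at hz
      exact WithTop.top_ne_coe hz
    obtain ⟨i, j, -, h, -⟩ := v.exists_map_evalPair_eq hv hpq hm hx' hy' hP0 hP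
    rw [h, WithTop.coe_inj, neg_inj] at hz
    exact ⟨_, hz.symm⟩
  have hunit : IsUnit m :=
    (Nat.isCoprime_iff_coprime.mpr hpq).isUnit_of_dvd' (hdvd y p hp hy) (hdvd x q hq hx)
  obtain rfl : m = 1 := by
    rcases Int.isUnit_iff.mp hunit with h | h <;> lia
  simpa using And.intro hx' hy'

theorem Polynomial.natDegree_linear_pow_add_C_sub_lt {R : Type*} [CommRing R] {p : ℕ} (hp : p ≠ 0)
    (u g r s : R) :
    ((C u * X + C g) ^ p + C r - C (u ^ p) * (X ^ p + C s)).natDegree < p := by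
  have hle : (C u * X + C g).natDegree ≤ 1 := natDegree_linear_le
  have hcoeff := coeff_pow_of_natDegree_le hle (m := p)
  rw [mul_one] at hcoeff
  refine lt_of_le_of_ne ?_ fun h ↦ ?_
  · compute_degree
  · have h₁ : ((C u * X + C g) ^ p + C r - C (u ^ p) * (X ^ p + C s)).coeff p = 0 := by
      simp [hcoeff, coeff_C, hp, coeff_C_mul, -map_pow]
    have h₂ := leadingCoeff_eq_zero.mp ((congrArg _ h).trans h₁)
    rw [h₂, natDegree_zero] at h
    exact hp h.symm

theorem Polynomial.scaling_of_pow_add_C_eq {K : Type*} [Field K] [CharZero K] {p q : ℕ}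
    (hp : 2 ≤ p) (hq : 2 ≤ q) {a b c c' d : K} {g : Polynomial K} (hd : d ≠ 0)
    (h : (C (C d) * X + C g : Polynomial (Polynomial K)) ^ p +
        C ((C a * X + C b) ^ q - C c') = C (C (d ^ p)) * (X ^ p + C (X ^ q - C c))) :
    a ^ q = d ^ p ∧ c' = d ^ p * c := by
  obtain ⟨g, rfl⟩ : ∃ g', g = C d * g' := ⟨C d⁻¹ * g, by
    rw [← mul_assoc, ← C_mul, mul_inv_cancel₀ hd, C_1, one_mul]⟩
  have hfac : (C (C d) * X + C (C d * g) : Polynomial (Polynomial K)) ^ p =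
      C (C (d ^ p)) * (X + C g) ^ p := by
    rw [C_pow, C_pow, ← mul_pow, C_mul]
    congr 1
    ring
  have hdC : (C (d ^ p) : Polynomial K) ≠ 0 := C_ne_zero.mpr (pow_ne_zero p hd)
  have hg : g = 0 := by
    have h₁ := congrArg (coeff · (p - 1)) h
    simp only [hfac, coeff_add, coeff_C_mul, coeff_X_add_C_pow, coeff_C, coeff_X_pow,
      if_neg (show p - 1 ≠ 0 by lia), if_neg (show p - 1 ≠ p by lia), add_zero, mul_zero,
      show p - (p - 1) = 1 by lia, pow_one, Nat.choose_symm_of_eq_add (show p = (p - 1) + 1 by lia),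
      Nat.choose_one_right] at h₁
    have h₂ := (mul_eq_zero.mp h₁).resolve_left hdC
    exact (mul_eq_zero.mp h₂).resolve_right (by exact_mod_cast (by lia : p ≠ 0))
  subst hg
  have h₁ : (C a * X + C b) ^ q - C c' = C (d ^ p) * (X ^ q - C c) := by
    refine C_injective ?_
    rw [hfac, C_0, add_zero] at h
    rw [C_mul]
    linear_combination h
  have had : a ^ q = d ^ p := by
    have hpow := coeff_pow_of_natDegree_le (natDegree_linear_le (a := a) (b := b)) (m := q)
    have h₂ := congrArg (coeff · q) h₁
    rw [mul_one] at hpow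
    simpa [hpow, coeff_C, show q ≠ 0 by lia, coeff_C_mul, -map_pow] using h₂
  have ha : a ≠ 0 := by
    rintro rfl
    rw [zero_pow (by lia)] at had
    exact pow_ne_zero p hd had.symm
  obtain ⟨b, rfl⟩ : ∃ b', b = a * b' := ⟨a⁻¹ * b, by field_simp⟩
  have hfac' : (C a * X + C (a * b)) ^ q = C (a ^ q) * (X + C b) ^ q := by
    rw [C_pow, ← mul_pow, C_mul]
    congr 1
    ring
  have hb : b = 0 := by
    have h₂ := congrArg (coeff · (q - 1)) h₁
    simp only [hfac', coeff_sub, coeff_C_mul, coeff_X_add_C_pow, coeff_C, coeff_X_pow,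
      if_neg (show q - 1 ≠ 0 by lia), if_neg (show q - 1 ≠ q by lia), sub_zero, mul_zero,
      show q - (q - 1) = 1 by lia, pow_one, Nat.choose_symm_of_eq_add (show q = (q - 1) + 1 by lia),
      Nat.choose_one_right] at h₂
    have h₃ := (mul_eq_zero.mp h₂).resolve_left (pow_ne_zero q ha)
    exact (mul_eq_zero.mp h₃).resolve_right (by exact_mod_cast (by lia : q ≠ 0))
  refine ⟨had, ?_⟩
  have h₂ := congrArg (eval 0) h₁
  simp only [hb, mul_zero, eval_sub, eval_mul, eval_pow, eval_add, eval_X, eval_C, add_zero,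
    zero_pow (show q ≠ 0 by lia)] at h₂
  linear_combination -h₂

theorem AddValuation.exists_scaling_of_lt {K A : Type*} [Field K] [CharZero K] [CommRing A]
    [Algebra K A] (v : AddValuation A (WithTop ℤ))
    (hv : ∀ r : K, r ≠ 0 → v (algebraMap K A r) = 0)
    {p q : ℕ} (hp : 2 ≤ p) (hlt : p < q) (hpq : p.Coprime q) {x y x' y' : A} {c c' : K}
    (hxy : x ^ p + y ^ q = algebraMap K A c) (hgen : Algebra.adjoin K {x, y} = ⊤)
    (hxy' : x' ^ p + y' ^ q = algebraMap K A c') (hgen' : Algebra.adjoin K {x', y'} = ⊤)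
    (hx : v x = ((-q : ℤ) : WithTop ℤ)) (hy : v y = ((-p : ℤ) : WithTop ℤ)) :
    ∃ a d : K, d ≠ 0 ∧ a ^ q = d ^ p ∧ c' = d ^ p * c := by
  obtain ⟨hx', hy'⟩ := v.generators_eq_of_adjoin_eq_top hv (by lia) (by lia) hpq hxy' hgen' hx hy
  have key : ∀ (P : Polynomial (Polynomial K)) (n : ℕ), P.natDegree < p →
      v (Polynomial.evalPair x y P) = ((-n : ℤ) : WithTop ℤ) →
      ∃ i j, (P.coeff i).coeff j ≠ 0 ∧ q * i + p * j = n ∧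
        ∀ i' j', (P.coeff i').coeff j' ≠ 0 → q * i' + p * j' ≤ n := by
    intro P n hP hn
    have hP0 : P ≠ 0 := by
      rintro rfl
      rw [_root_.map_zero, v.map_zero] at hn
      exact WithTop.top_ne_coe hn
    obtain ⟨i, j, hij, h, hmax⟩ := v.exists_map_evalPair_eq hv hpq one_pos
      (by simpa using hx) (by simpa using hy) hP0 hP
    rw [h, WithTop.coe_inj, neg_inj, one_mul, Nat.cast_inj] at hn
    exact ⟨i, j, hij, hn, fun i' j' h' ↦ hn ▸ hmax i' j' h'⟩
  obtain ⟨P, hP, rfl⟩ := exists_evalPair_eq_of_adjoin_eq_top (by lia) hxy hgen x'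
  obtain ⟨Q, hQ, rfl⟩ := exists_evalPair_eq_of_adjoin_eq_top (by lia) hxy hgen y'
  obtain ⟨i, j, hij, hijq, hPmax⟩ := key P q hP hx'
  obtain ⟨-, -, -, -, hQmax⟩ := key Q p hQ hy'
  have hP_eq : P = .C (.C ((P.coeff 1).coeff 0)) * .X + .C (P.coeff 0) := by
    ext i j
    rcases i with _ | _ | i
    · simp
    · rcases j with _ | j
      · simp [Polynomial.coeff_C]
      · have : (P.coeff 1).coeff (j + 1) = 0 := by
          by_contra h
          have := hPmax _ _ h
          nlinarith
        simp [Polynomial.coeff_C, this]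
    · have : (P.coeff (i + 2)).coeff j = 0 := by
        by_contra h
        have := hPmax _ _ h
        nlinarith
      simp [this]
  have hQ_eq : Q = .C (.C ((Q.coeff 0).coeff 1) * .X + .C ((Q.coeff 0).coeff 0)) := by
    ext i j
    rcases i with _ | i
    · rcases j with _ | _ | j
      · simp
      · simp [Polynomial.coeff_C]
      · have : (Q.coeff 0).coeff (j + 2) = 0 := by
          by_contra h
          have := hQmax _ _ h
          nlinarith
        simp [Polynomial.coeff_C, this]
    · have : (Q.coeff (i + 1)).coeff j = 0 := by
        by_contra h
        have := hQmax _ _ h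
        nlinarith
      simp [this]
  have hd : (P.coeff 1).coeff 0 ≠ 0 := by
    rcases i with _ | _ | i
    · have : p ∣ q := ⟨j, by lia⟩
      have := Nat.Coprime.eq_one_of_dvd hpq this
      lia
    · rcases j with _ | j
      · exact hij
      · nlinarith
    · nlinarith
  generalize (P.coeff 1).coeff 0 = d at *
  generalize (Q.coeff 0).coeff 1 = a at *
  generalize (Q.coeff 0).coeff 0 = b at *
  generalize P.coeff 0 = g at *
  refine ⟨a, d, hd, Polynomial.scaling_of_pow_add_C_eq hp (by lia) (b := b) (g := g) hd ?_⟩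
  rw [← sub_eq_zero]
  by_contra hne
  obtain ⟨i, j, -, h, -⟩ := v.exists_map_evalPair_eq hv hpq one_pos
      (by simpa using hx) (by simpa using hy) hne (by
        rw [Polynomial.C_pow]
        exact Polynomial.natDegree_linear_pow_add_C_sub_lt (by lia) _ _ _ _)
  refine WithTop.top_ne_coe (Eq.trans ?_ h)
  rw [← v.map_zero]
  congr 1
  rw [hP_eq, hQ_eq] at hxy'
  simp only [_root_.map_add, _root_.map_mul, _root_.map_sub, _root_.map_pow, Polynomial.evalPair_C,
    Polynomial.evalPair_X, Polynomial.aeval_X, Polynomial.aeval_C] at hxy' ⊢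
  linear_combination -hxy' + algebraMap K A d ^ p * hxy

/-- Two pairs of generators of `A` lying on the curves `x ^ p + y ^ q = c` and
`x ^ p + y ^ q = c'` force `c' / c` to be a `q`-th power. -/
theorem AddValuation.exists_scaling {K A : Type*} [Field K] [CharZero K] [CommRing A]
    [Algebra K A] (v : AddValuation A (WithTop ℤ))
    (hv : ∀ r : K, r ≠ 0 → v (algebraMap K A r) = 0)
    {p q : ℕ} (hp : 2 ≤ p) (hq : 2 ≤ q) (hpq : p.Coprime q) {x y x' y' : A} {c c' : K}
    (hxy : x ^ p + y ^ q = algebraMap K A c) (hgen : Algebra.adjoin K {x, y} = ⊤)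
    (hxy' : x' ^ p + y' ^ q = algebraMap K A c') (hgen' : Algebra.adjoin K {x', y'} = ⊤)
    (hx : v x = ((-q : ℤ) : WithTop ℤ)) (hy : v y = ((-p : ℤ) : WithTop ℤ)) :
    ∃ a : K, a ≠ 0 ∧ c' = a ^ q * c := by
  rcases lt_trichotomy p q with hlt | rfl | hlt
  · obtain ⟨a, d, hd, had, hc⟩ :=
      v.exists_scaling_of_lt hv hp hlt hpq hxy hgen hxy' hgen' hx hy
    refine ⟨a, ?_, by rw [had, hc]⟩
    rintro rfl
    rw [zero_pow (by lia)] at had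
    exact pow_ne_zero p hd had.symm
  · rw [Nat.coprime_self] at hpq
    lia
  · rw [add_comm] at hxy hxy'
    rw [Set.pair_comm] at hgen hgen'
    obtain ⟨a, d, hd, -, hc⟩ :=
      v.exists_scaling_of_lt hv hq hlt hpq.symm hxy hgen hxy' hgen' hy hx
    exact ⟨d, hd, hc⟩

theorem PowerSeries.exists_pow_eq_one_add {K : Type*} [Field K] [CharZero K] {p n : ℕ}
    (hp : p ≠ 0) (hn : n ≠ 0) (c : K) :
    ∃ w : PowerSeries K, w ^ p = 1 + C c * X ^ n := by
  have hpow : ∀ k : ℕ, binomialSeries K (1 / p : ℚ) ^ k = binomialSeries K (k / p : ℚ) := by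
    intro k
    induction k with
    | zero => simp
    | succ k ih => rw [pow_succ, ih, ← binomialSeries_add]; congr 1; push_cast; ring
  have hroot : binomialSeries K (1 / p : ℚ) ^ p = 1 + X := by
    rw [hpow, div_self (by exact_mod_cast hp)]
    simpa using binomialSeries_nat (R := ℚ) (A := K) 1
  refine ⟨expand n hn (rescale c (binomialSeries K (1 / p : ℚ))), ?_⟩
  rw [← map_pow, ← map_pow, hroot]
  simp [expand_C]

theorem HahnSeries.algebraMap_eq_single {K : Type*} [Field K] (r : K) :
    algebraMap K (HahnSeries ℤ K) r = single 0 r := by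
  rw [HahnSeries.algebraMap_apply', PowerSeries.algebraMap_apply, Algebra.algebraMap_self,
    RingHom.id_apply, ofPowerSeries_C, C_apply]

theorem HahnSeries.addVal_algebraMap {K : Type*} [Field K] {r : K} (hr : r ≠ 0) :
    addVal ℤ K (algebraMap K (HahnSeries ℤ K) r) = 0 := by
  rw [addVal_apply, algebraMap_eq_single, orderTop_single hr, WithTop.coe_zero]

/-- The curve `x ^ p + y ^ q = c` has a Laurent series point at infinity, with poles of order `q`
and `p`. -/
theorem HahnSeries.exists_pow_add_pow_eq {K : Type*} [Field K] [CharZero K] {p q : ℕ}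
    (hp : p ≠ 0) (hq : q ≠ 0) (hpq : p.Coprime q) (c : K) :
    ∃ x y : HahnSeries ℤ K, x ^ p + y ^ q = algebraMap K (HahnSeries ℤ K) c ∧
      addVal ℤ K x = ((-q : ℤ) : WithTop ℤ) ∧ addVal ℤ K y = ((-p : ℤ) : WithTop ℤ) := by
  obtain ⟨ε, δ, hε, hεδ⟩ : ∃ ε δ : K, ε ≠ 0 ∧ δ ^ p + ε ^ q = 0 := by
    rcases Nat.even_or_odd q with he | ho
    · have : Odd p := by
        rw [← Nat.not_even_iff_odd]
        intro he'
        have := Nat.dvd_gcd he'.two_dvd he.two_dvd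
        rw [hpq.gcd_eq_one] at this
        lia
      exact ⟨1, -1, one_ne_zero, by simp [this.neg_one_pow]⟩
    · exact ⟨-1, 1, by simp, by simp [ho.neg_one_pow]⟩
  have hδ : δ ^ p ≠ 0 := by
    intro h
    rw [h, zero_add] at hεδ
    exact pow_ne_zero q hε hεδ
  obtain ⟨w, hw⟩ := PowerSeries.exists_pow_eq_one_add hp (mul_ne_zero hp hq) (c / δ ^ p)
  have hs : ∀ (n k : ℕ) (r : K), (single (-n : ℤ) r : HahnSeries ℤ K) ^ k =
      single (-(n * k : ℕ) : ℤ) (r ^ k) := by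
    intro n k r
    rw [single_pow]
    congr 1
    simp [mul_comm]
  have hy : addVal ℤ K (single (-p : ℤ) ε) = ((-p : ℤ) : WithTop ℤ) := by
    rw [addVal_apply, orderTop_single hε]
  have hxy : (single (-q : ℤ) δ * ofPowerSeries ℤ K w) ^ p + single (-p : ℤ) ε ^ q =
      algebraMap K (HahnSeries ℤ K) c := by
    rw [mul_pow, ← RingHom.map_pow, hw, hs, hs, _root_.map_add, _root_.map_mul,
      ofPowerSeries_X_pow, ofPowerSeries_C, _root_.map_one, mul_comm q p, mul_add, mul_one,
      add_right_comm, ← single_add, hεδ, _root_.map_zero, zero_add, C_apply, single_mul_single,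
      single_mul_single]
    simp [mul_div_cancel₀, hδ, algebraMap_eq_single]
  refine ⟨_, _, hxy, ?_, hy⟩
  obtain ⟨m, -, hx, hy'⟩ := (addVal ℤ K).exists_eq_neg_mul_of_pow_add_pow_eq
    (fun r hr ↦ addVal_algebraMap hr) hp hq hpq hxy (by
      rw [hy, ← WithTop.coe_zero, WithTop.coe_lt_coe]
      lia)
  rw [hy, WithTop.coe_inj, neg_inj] at hy'
  have hm : m = 1 := mul_right_cancel₀ (Nat.cast_ne_zero.mpr hp) (hy'.symm.trans (one_mul _).symm)
  rw [hx, hm, one_mul]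

theorem RatFunc.modEq_of_eq_pow_mul {K : Type*} [Field K] {q m n : ℕ} {a : RatFunc K}
    (ha : a ≠ 0) (h : (X ^ m)⁻¹ = a ^ q * (X ^ n)⁻¹) : n ≡ m [MOD q] := by
  have hX : ∀ k : ℕ, (X ^ k : RatFunc K) ≠ 0 := fun k ↦ pow_ne_zero k RatFunc.X_ne_zero
  have hpow : ∀ (f : RatFunc K) (k : ℕ), f ≠ 0 → (f ^ k).intDegree = k * f.intDegree := by
    intro f k hf
    induction k with
    | zero => simp
    | succ k ih => rw [pow_succ, intDegree_mul (pow_ne_zero k hf) hf, ih]; push_cast; ring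
  have := congrArg intDegree h
  rw [intDegree_mul (pow_ne_zero q ha) (inv_ne_zero (hX n)), intDegree_inv, intDegree_inv,
    hpow _ _ ha, hpow _ _ X_ne_zero, hpow _ _ X_ne_zero, intDegree_X] at this
  refine Int.natCast_modEq_iff.mp ((Int.modEq_iff_dvd).mpr ⟨-a.intDegree, ?_⟩)
  linarith

theorem Ideal.mk_X_pow_add_mk_X_pow {K : Type*} [Field K] (I : Ideal (MvPolynomial (Fin 2) K))
    {p q : ℕ} {u : K} (hu : u ≠ 0)
    (h : MvPolynomial.C u * (MvPolynomial.X 0 ^ p + MvPolynomial.X 1 ^ q) - 1 ∈ I) :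
    Ideal.Quotient.mk I (MvPolynomial.X 0) ^ p + Ideal.Quotient.mk I (MvPolynomial.X 1) ^ q =
      algebraMap K (MvPolynomial (Fin 2) K ⧸ I) u⁻¹ := by
  have h' := Ideal.Quotient.eq_zero_iff_mem.mpr h
  rw [map_sub, map_mul, map_add, map_pow, map_pow, map_one, sub_eq_zero] at h'
  have hinv : algebraMap K (MvPolynomial (Fin 2) K ⧸ I) u⁻¹ *
      Ideal.Quotient.mk I (MvPolynomial.C u) = 1 := by
    change algebraMap K (MvPolynomial (Fin 2) K ⧸ I) u⁻¹ * algebraMap K _ u = 1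
    rw [← map_mul, inv_mul_cancel₀ hu, map_one]
  exact (left_inv_eq_right_inv hinv h').symm

theorem Ideal.adjoin_mk_X_eq_top {K : Type*} [Field K] (I : Ideal (MvPolynomial (Fin 2) K)) :
    Algebra.adjoin K {Ideal.Quotient.mk I (MvPolynomial.X 0),
      Ideal.Quotient.mk I (MvPolynomial.X 1)} = ⊤ := by
  have h := congrArg (Subalgebra.map (Ideal.Quotient.mkₐ K I))
    (MvPolynomial.adjoin_range_X (R := K) (σ := Fin 2))
  rw [AlgHom.map_adjoin, Algebra.map_top, (AlgHom.range_eq_top _).mpr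
    (Ideal.Quotient.mkₐ_surjective _ _), ← Set.range_comp] at h
  rw [← h]
  congr 1
  ext z
  simp [Fin.exists_fin_two, eq_comm]

theorem curveRingPQ_pow_add_pow (p q j : ℕ) :
    (Ideal.Quotient.mk _ (MvPolynomial.X 0) : curveRingPQ p q j) ^ p +
      (Ideal.Quotient.mk _ (MvPolynomial.X 1) : curveRingPQ p q j) ^ q =
    algebraMap (RatFunc ℂ) (curveRingPQ p q j) (RatFunc.X ^ j)⁻¹ :=
  Ideal.mk_X_pow_add_mk_X_pow _ (pow_ne_zero j RatFunc.X_ne_zero)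
    (Ideal.mem_span_singleton_self _)

theorem exists_addValuation_curveRingPQ {p q : ℕ} (hp : p ≠ 0) (hq : q ≠ 0) (hpq : p.Coprime q)
    (j : ℕ) : ∃ v : AddValuation (curveRingPQ p q j) (WithTop ℤ),
      (∀ r : RatFunc ℂ, r ≠ 0 → v (algebraMap _ _ r) = 0) ∧
      v (Ideal.Quotient.mk _ (MvPolynomial.X 0)) = ((-q : ℤ) : WithTop ℤ) ∧
      v (Ideal.Quotient.mk _ (MvPolynomial.X 1)) = ((-p : ℤ) : WithTop ℤ) := by
  obtain ⟨x, y, hxy, hx, hy⟩ := HahnSeries.exists_pow_add_pow_eq hp hq hpq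
    ((RatFunc.X ^ j)⁻¹ : RatFunc ℂ)
  have hX : (RatFunc.X ^ j : RatFunc ℂ) ≠ 0 := pow_ne_zero j RatFunc.X_ne_zero
  let θ : curveRingPQ p q j →ₐ[RatFunc ℂ] HahnSeries ℤ (RatFunc ℂ) :=
    Ideal.Quotient.liftₐ _ (MvPolynomial.aeval ![x, y]) fun a ha ↦ by
      revert a
      change Ideal.span _ ≤ RingHom.ker (MvPolynomial.aeval ![x, y])
      rw [Ideal.span_singleton_le_iff_mem, RingHom.mem_ker]
      simp only [map_sub, map_mul, map_add, map_pow (MvPolynomial.aeval ![x, y]),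
        MvPolynomial.aeval_X, MvPolynomial.aeval_C, Matrix.cons_val_zero, Matrix.cons_val_one,
        hxy, map_one]
      rw [← map_mul, mul_inv_cancel₀ hX, map_one, sub_self]
  refine ⟨(HahnSeries.addVal ℤ (RatFunc ℂ)).comap (θ : curveRingPQ p q j →+* _), ?_, ?_, ?_⟩
  · intro r hr
    change HahnSeries.addVal ℤ (RatFunc ℂ) (θ _) = _
    rw [θ.commutes]
    exact HahnSeries.addVal_algebraMap hr
  · rw [← hx]
    exact congrArg (HahnSeries.addVal ℤ (RatFunc ℂ)) <| MvPolynomial.aeval_X ![x, y] 0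
  · rw [← hy]
    exact congrArg (HahnSeries.addVal ℤ (RatFunc ℂ)) <| MvPolynomial.aeval_X ![x, y] 1

/-- **Key step for nonisomorphy.** Let `p ≥ 2` be prime and `q ≥ 3` coprime with `p`.
If the curves `Y_ℓ = {x^p + y^q = t^{-ℓ}}` and `Y_{ℓ'} = {x^p + y^q = t^{-ℓ'}}` over
`K = ℂ(t)` are isomorphic as `K`-algebras for some `ℓ, ℓ' ≥ 1`, then `ℓ ≡ ℓ' (mod q)`. -/
theorem curvesPQ_iso_imp_cong (p q : ℕ) (hp : p.Prime) (hq : 3 ≤ q)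
    (hpq : Nat.gcd p q = 1) (ℓ ℓ' : ℕ) (hℓ : 1 ≤ ℓ) (hℓ' : 1 ≤ ℓ')
    (hiso : Nonempty (curveRingPQ p q ℓ ≃ₐ[RatFunc ℂ] curveRingPQ p q ℓ')) :
    ℓ ≡ ℓ' [MOD q] := by
  obtain ⟨φ⟩ := hiso
  have hcop : p.Coprime q := hpq
  obtain ⟨v, hv, hx, hy⟩ := exists_addValuation_curveRingPQ hp.ne_zero (by lia) hcop ℓ
  obtain ⟨a, ha, hc⟩ := v.exists_scaling hv hp.two_le (by lia) hcop (curveRingPQ_pow_add_pow p q ℓ)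
    (Ideal.adjoin_mk_X_eq_top _)
    (x' := φ.symm (Ideal.Quotient.mk _ (MvPolynomial.X 0)))
    (y' := φ.symm (Ideal.Quotient.mk _ (MvPolynomial.X 1)))
    (c' := (RatFunc.X ^ ℓ')⁻¹)
    (by
      have h := congrArg φ.symm (curveRingPQ_pow_add_pow p q ℓ')
      rwa [map_add, map_pow φ.symm, map_pow φ.symm, φ.symm.commutes] at h)
    (by
      have h := congrArg (Subalgebra.map φ.symm.toAlgHom) (Ideal.adjoin_mk_X_eq_top _)
      rw [AlgHom.map_adjoin, Algebra.map_top, (AlgHom.range_eq_top _).mpr φ.symm.surjective,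
        Set.image_pair] at h
      exact h) hx hy
  exact RatFunc.modEq_of_eq_pow_mul ha hc
end

section
/- Let n ≥ 1 and m ≥ 2 be integers, and let ℓ, ℓ' ≥ 1 be integers both coprime with m such that ℓ' is congruent neither to ℓ nor to −ℓ modulo m. Let R_{n,m,ℓ} = ℂ[x₁,…,xₙ,y,z,t]/(t^ℓ(x₁²⋯xₙ²·z − y^m) − 1) and R_{n,m,ℓ'} = ℂ[x₁,…,xₙ,y,z,t]/(t^{ℓ'}(x₁²⋯xₙ²·z − y^m) − 1). Then the ℂ-algebras R_{n,m,ℓ} and R_{n,m,ℓ'} are not isomorphic, but the Laurent polynomial rings R_{n,m,ℓ}[u,u⁻¹] and R_{n,m,ℓ'}[u,u⁻¹] (i.e. LaurentPolynomial R_{n,m,ℓ} and LaurentPolynomial R_{n,m,ℓ'}) are isomorphic as ℂ-algebras. -/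
open MvPolynomial

/-- `R_{n,m,ℓ} = ℂ[x₁,…,xₙ,y,z,t]/(t^ℓ(x₁²⋯xₙ²·z − y^m) − 1)`, the coordinate ring of
the hypersurface `X_{n,m,ℓ} ⊂ 𝔸^{n+3}`; the variables `x₁,…,xₙ` are indexed by
`0,…,n-1`, `y` by `n`, `z` by `n+1` and `t` by `n+2` in `Fin (n+3)`. -/
noncomputable abbrev negKodairaRing (n m ℓ : ℕ) : Type :=
  MvPolynomial (Fin (n + 3)) ℂ ⧸ Ideal.span
    {(X (⟨n + 2, by omega⟩ : Fin (n + 3)) : MvPolynomial (Fin (n + 3)) ℂ) ^ ℓ *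
      ((∏ i : Fin n, (X (Fin.castAdd 3 i)) ^ 2) * X (⟨n + 1, by omega⟩ : Fin (n + 3)) -
        (X (⟨n, by omega⟩ : Fin (n + 3))) ^ m) - 1}

namespace NegKodaira

section Interface

variable (n m ℓ : ℕ)

/-- The class of `xᵢ` in `R_{n,m,ℓ}`. -/
noncomputable def xv (i : Fin n) : negKodairaRing n m ℓ :=
  Ideal.Quotient.mk _ (X (Fin.castAdd 3 i))

/-- The class of `y` in `R_{n,m,ℓ}`. -/
noncomputable def yv : negKodairaRing n m ℓ := Ideal.Quotient.mk _ (X ⟨n, by omega⟩)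

/-- The class of `z` in `R_{n,m,ℓ}`. -/
noncomputable def zv : negKodairaRing n m ℓ := Ideal.Quotient.mk _ (X ⟨n + 1, by omega⟩)

/-- The class of `t` in `R_{n,m,ℓ}`. -/
noncomputable def tv : negKodairaRing n m ℓ := Ideal.Quotient.mk _ (X ⟨n + 2, by omega⟩)

theorem tv_relation :
    tv n m ℓ ^ ℓ * ((∏ i, xv n m ℓ i) ^ 2 * zv n m ℓ - yv n m ℓ ^ m) = 1 := by
  rw [← sub_eq_zero, ← Finset.prod_pow]
  simp only [xv, yv, zv, tv, ← map_pow, ← map_prod, ← map_mul, ← map_sub]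
  rw [← map_one (Ideal.Quotient.mk _), ← map_sub, Ideal.Quotient.eq_zero_iff_mem]
  exact Ideal.subset_span rfl

variable {n m ℓ}

/-- The homomorphism out of `R_{n,m,ℓ}` with prescribed values on the generators. -/
noncomputable def lift {S : Type*} [CommRing S] [Algebra ℂ S] (x : Fin n → S) (y z t : S)
    (h : t ^ ℓ * ((∏ i, x i) ^ 2 * z - y ^ m) = 1) : negKodairaRing n m ℓ →ₐ[ℂ] S :=
  Ideal.Quotient.liftₐ _ (aeval (Fin.append x ![y, z, t])) (by
    intro a ha
    rw [← RingHom.mem_ker]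
    refine (Ideal.span_le.2 ?_ : _ ≤ RingHom.ker (aeval (Fin.append x ![y, z, t]))) ha
    rintro _ rfl
    have e0 : (⟨n, by omega⟩ : Fin (n + 3)) = Fin.natAdd n (0 : Fin 3) := rfl
    have e1 : (⟨n + 1, by omega⟩ : Fin (n + 3)) = Fin.natAdd n (1 : Fin 3) := rfl
    have e2 : (⟨n + 2, by omega⟩ : Fin (n + 3)) = Fin.natAdd n (2 : Fin 3) := rfl
    rw [SetLike.mem_coe, RingHom.mem_ker, e0, e1, e2]
    simp only [map_sub, map_mul, map_pow, map_prod, aeval_X, map_one, Fin.append_left,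
      Fin.append_right]
    rw [Finset.prod_pow, sub_eq_zero]
    exact h)

section lift

variable {S : Type*} [CommRing S] [Algebra ℂ S] (x : Fin n → S) (y z t : S)
    (h : t ^ ℓ * ((∏ i, x i) ^ 2 * z - y ^ m) = 1)

@[simp] theorem lift_xv (i : Fin n) : lift x y z t h (xv n m ℓ i) = x i := by
  have : lift x y z t h (xv n m ℓ i) = aeval (Fin.append x ![y, z, t]) (X (Fin.castAdd 3 i)) := rfl
  rw [this, aeval_X, Fin.append_left]

@[simp] theorem lift_yv : lift x y z t h (yv n m ℓ) = y := by
  have : lift x y z t h (yv n m ℓ) =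
    aeval (Fin.append x ![y, z, t]) (X (Fin.natAdd n (0 : Fin 3))) := rfl
  rw [this, aeval_X, Fin.append_right]; rfl

@[simp] theorem lift_zv : lift x y z t h (zv n m ℓ) = z := by
  have : lift x y z t h (zv n m ℓ) =
    aeval (Fin.append x ![y, z, t]) (X (Fin.natAdd n (1 : Fin 3))) := rfl
  rw [this, aeval_X, Fin.append_right]; rfl

@[simp] theorem lift_tv : lift x y z t h (tv n m ℓ) = t := by
  have : lift x y z t h (tv n m ℓ) =
    aeval (Fin.append x ![y, z, t]) (X (Fin.natAdd n (2 : Fin 3))) := rfl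
  rw [this, aeval_X, Fin.append_right]; rfl

end lift

theorem generator_cases {p : negKodairaRing n m ℓ → Prop} (hx : ∀ i, p (xv n m ℓ i))
    (hy : p (yv n m ℓ)) (hz : p (zv n m ℓ)) (ht : p (tv n m ℓ)) (i : Fin (n + 3)) :
    p (Ideal.Quotient.mk _ (X i)) := by
  induction i using Fin.addCases with
  | left i => exact hx i
  | right i =>
    fin_cases i
    · exact hy
    · exact hz
    · exact ht

theorem induction {p : negKodairaRing n m ℓ → Prop} (hx : ∀ i, p (xv n m ℓ i))
    (hy : p (yv n m ℓ)) (hz : p (zv n m ℓ)) (ht : p (tv n m ℓ))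
    (hC : ∀ c : ℂ, p (algebraMap ℂ _ c)) (hadd : ∀ a b, p a → p b → p (a + b))
    (hmul : ∀ a b, p a → p b → p (a * b)) (a : negKodairaRing n m ℓ) : p a := by
  obtain ⟨f, rfl⟩ := Ideal.Quotient.mk_surjective a
  induction f using MvPolynomial.induction_on with
  | C c => exact hC c
  | add f g hf hg => rw [map_add]; exact hadd _ _ hf hg
  | mul_X f i hf => rw [map_mul]; exact hmul _ _ hf (generator_cases hx hy hz ht i)

theorem algHom_ext {S : Type*} [CommRing S] [Algebra ℂ S] {f g : negKodairaRing n m ℓ →ₐ[ℂ] S}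
    (hx : ∀ i, f (xv n m ℓ i) = g (xv n m ℓ i)) (hy : f (yv n m ℓ) = g (yv n m ℓ))
    (hz : f (zv n m ℓ) = g (zv n m ℓ)) (ht : f (tv n m ℓ) = g (tv n m ℓ)) : f = g := by
  refine Ideal.Quotient.algHom_ext _ (MvPolynomial.algHom_ext fun i => ?_)
  exact generator_cases (p := fun a => f a = g a) hx hy hz ht i

theorem isUnit_tv (hℓ : 1 ≤ ℓ) : IsUnit (tv n m ℓ) :=
  (isUnit_pow_iff (by omega)).1 (IsUnit.of_mul_eq_one _ (tv_relation n m ℓ))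

variable (n m) in
/-- The unit `t` of `R_{n,m,ℓ}`. -/
noncomputable def tu (hℓ : 1 ≤ ℓ) : (negKodairaRing n m ℓ)ˣ := (isUnit_tv hℓ).unit

@[simp] theorem val_tu (hℓ : 1 ≤ ℓ) : (tu n m hℓ : negKodairaRing n m ℓ) = tv n m ℓ := rfl

theorem relation_iff_of_units {S : Type*} [CommRing S] {x y z : S} {t : Sˣ} :
    (t : S) ^ ℓ * (x ^ 2 * z - y ^ m) = 1 ↔ x ^ 2 * z = y ^ m + ((t ^ (-(ℓ : ℤ)) : Sˣ) : S) := by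
  rw [zpow_neg, zpow_natCast, ← sub_eq_iff_eq_add', ← Units.val_pow_eq_pow_val,
    ← Units.eq_inv_mul_iff_mul_eq, mul_one]

theorem relation (hℓ : 1 ≤ ℓ) : (∏ i, xv n m ℓ i) ^ 2 * zv n m ℓ =
    yv n m ℓ ^ m + ((tu n m hℓ ^ (-(ℓ : ℤ)) : (negKodairaRing n m ℓ)ˣ) : negKodairaRing n m ℓ) :=
  relation_iff_of_units.1 (tv_relation n m ℓ)

end Interface

section LaurentIso

section

variable {R S : Type*} [Semiring R] [Semiring S] [Algebra ℂ R] [Algebra ℂ S]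

/-- The map induced on units by an algebra homomorphism. -/
noncomputable abbrev unitsMap (f : R →ₐ[ℂ] S) : Rˣ →* Sˣ := Units.map (f : R →* S)

theorem val_unitsMap (f : R →ₐ[ℂ] S) (u : Rˣ) : (unitsMap f u : S) = f u := rfl

theorem map_val_zpow (f : R →ₐ[ℂ] S) (u : Rˣ) (k : ℤ) :
    f ((u ^ k : Rˣ) : R) = ((unitsMap f u ^ k : Sˣ) : S) := by
  rw [← map_zpow, val_unitsMap]

end

/-- The homomorphism from a Laurent polynomial ring with prescribed values on the coefficients and
on the variable. -/
noncomputable def laurentLift {R S : Type*} [CommRing R] [CommRing S] [Algebra ℂ R] [Algebra ℂ S]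
    (f : R →ₐ[ℂ] S) (u : Sˣ) : LaurentPolynomial R →ₐ[ℂ] S :=
  { LaurentPolynomial.eval₂ f.toRingHom u with
    commutes' := fun c => by
      have : algebraMap ℂ (LaurentPolynomial R) c = LaurentPolynomial.C (algebraMap ℂ R c) := rfl
      simp [this] }

section

variable {R S : Type*} [CommRing R] [CommRing S] [Algebra ℂ R] [Algebra ℂ S]

@[simp] theorem laurentLift_C (f : R →ₐ[ℂ] S) (u : Sˣ) (a : R) :
    laurentLift f u (LaurentPolynomial.C a) = f a :=
  LaurentPolynomial.eval₂_C _ _ _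

@[simp] theorem laurentLift_T (f : R →ₐ[ℂ] S) (u : Sˣ) (k : ℤ) :
    laurentLift f u (LaurentPolynomial.T k) = ((u ^ k : Sˣ) : S) :=
  LaurentPolynomial.eval₂_T _ _ _

/-- The inclusion of the coefficients in a Laurent polynomial ring. -/
noncomputable def laurentC (R : Type*) [CommRing R] [Algebra ℂ R] : R →ₐ[ℂ] LaurentPolynomial R :=
  { LaurentPolynomial.C with commutes' := fun _ => rfl }

@[simp] theorem laurentC_apply (a : R) : laurentC R a = LaurentPolynomial.C a := rfl

/-- The variable of a Laurent polynomial ring, as a unit. -/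
noncomputable def Tu (R : Type*) [CommRing R] : (LaurentPolynomial R)ˣ :=
  ⟨LaurentPolynomial.T 1, LaurentPolynomial.T (-1), by rw [← LaurentPolynomial.T_add]; simp,
    by rw [← LaurentPolynomial.T_add]; simp⟩

omit [Algebra ℂ R] in
theorem val_Tu : (Tu R : LaurentPolynomial R) = LaurentPolynomial.T 1 := rfl

omit [Algebra ℂ R] in
@[simp] theorem val_Tu_zpow (k : ℤ) :
    ((Tu R ^ k : (LaurentPolynomial R)ˣ) : LaurentPolynomial R) = LaurentPolynomial.T k := by
  obtain ⟨k, rfl | rfl⟩ := k.eq_nat_or_neg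
  · rw [zpow_natCast, Units.val_pow_eq_pow_val, val_Tu, LaurentPolynomial.T_pow, mul_one]
  · rw [zpow_neg, zpow_natCast, ← inv_pow, Units.val_pow_eq_pow_val]
    have : ((Tu R)⁻¹ : (LaurentPolynomial R)ˣ) = (LaurentPolynomial.T (-1) : LaurentPolynomial R) :=
      rfl
    rw [this, LaurentPolynomial.T_pow, mul_neg, mul_one]

theorem laurent_algHom_ext {f g : LaurentPolynomial R →ₐ[ℂ] S}
    (hC : f.comp (laurentC R) = g.comp (laurentC R))
    (hT : f (LaurentPolynomial.T 1) = g (LaurentPolynomial.T 1)) : f = g := by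
  have hu : unitsMap f (Tu R) = unitsMap g (Tu R) := Units.ext hT
  have hk (k : ℤ) : f (LaurentPolynomial.T k) = g (LaurentPolynomial.T k) := by
    rw [← val_Tu_zpow, map_val_zpow, map_val_zpow, hu]
  refine AlgHom.ext fun p => ?_
  induction p using LaurentPolynomial.induction_on' with
  | add p q hp hq => rw [map_add, map_add, hp, hq]
  | C_mul_T k a =>
    rw [map_mul, map_mul, hk]
    congr 1
    exact DFunLike.congr_fun hC a

end

theorem torusChange_relation {S : Type*} [CommRing S] {m ℓ ℓ' : ℕ} {x y z : S} {t u : Sˣ}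
    {p q a b : ℤ} (h : x ^ 2 * z = y ^ m + ((t ^ (-(ℓ' : ℤ)) : Sˣ) : S))
    (h1 : p * ℓ + m * a = ℓ') (h2 : q * ℓ + m * b = 0) :
    ((t ^ p * u ^ q : Sˣ) : S) ^ ℓ *
      (x ^ 2 * (z * (((t ^ a * u ^ b) ^ m : Sˣ) : S)) -
        (y * ((t ^ a * u ^ b : Sˣ) : S)) ^ m) = 1 := by
  have hu : (t ^ p * u ^ q) ^ (-(ℓ : ℤ)) = t ^ (-(ℓ' : ℤ)) * (t ^ a * u ^ b) ^ m := by
    rw [mul_zpow, mul_pow, ← zpow_mul, ← zpow_mul, ← zpow_natCast, ← zpow_natCast,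
      ← zpow_mul, ← zpow_mul, ← mul_assoc, ← zpow_add, ← h1]
    congr 2
    · ring
    · linarith
  rw [relation_iff_of_units, hu, ← mul_assoc, h, Units.val_mul (t ^ (-(ℓ' : ℤ))),
    Units.val_pow_eq_pow_val, mul_pow, add_mul]

theorem torus_eval {G : Type*} [CommGroup G] (t u : G) (p q r s i j : ℤ) :
    (t ^ p * u ^ q) ^ i * (t ^ r * u ^ s) ^ j = t ^ (p * i + r * j) * u ^ (q * i + s * j) := by
  rw [mul_zpow, mul_zpow, ← zpow_mul, ← zpow_mul, ← zpow_mul, ← zpow_mul, mul_mul_mul_comm,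
    ← zpow_add, ← zpow_add]

theorem torus_mul {G : Type*} [CommGroup G] (t u : G) (i j k l : ℤ) :
    (t ^ i * u ^ j) * (t ^ k * u ^ l) = t ^ (i + k) * u ^ (j + l) := by
  rw [mul_mul_mul_comm, ← zpow_add, ← zpow_add]

variable {n m : ℕ}

variable (n m) in
/-- The unit `t` of `R_{n,m,ℓ}[u,u⁻¹]`. -/
noncomputable def tL {ℓ : ℕ} (hℓ : 1 ≤ ℓ) : (LaurentPolynomial (negKodairaRing n m ℓ))ˣ :=
  unitsMap (laurentC (negKodairaRing n m ℓ)) (tu n m hℓ)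

section

variable {S : Type*} [CommRing S] [Algebra ℂ S] {ℓ ℓ' : ℕ} {x : Fin n → S} {y z : S} {t : Sˣ}
  (h : (∏ i, x i) ^ 2 * z = y ^ m + ((t ^ (-(ℓ' : ℤ)) : Sˣ) : S))
  (u : Sˣ) (p q r s a b : ℤ) (h1 : p * ℓ + m * a = ℓ') (h2 : q * ℓ + m * b = 0)

/-- The monomial change of the torus coordinates `(t, u)`, together with the rescaling of `y` and
`z` which it forces. -/
noncomputable def torusChange : LaurentPolynomial (negKodairaRing n m ℓ) →ₐ[ℂ] S :=
  laurentLift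
    (lift x (y * ((t ^ a * u ^ b : Sˣ) : S)) (z * (((t ^ a * u ^ b) ^ m : Sˣ) : S))
      ((t ^ p * u ^ q : Sˣ) : S) (torusChange_relation h h1 h2))
    (t ^ r * u ^ s)

theorem torusChange_C_xv (i : Fin n) :
    torusChange h u p q r s a b h1 h2 (LaurentPolynomial.C (xv n m ℓ i)) = x i := by
  rw [torusChange, laurentLift_C, lift_xv]

theorem torusChange_C_yv : torusChange h u p q r s a b h1 h2 (LaurentPolynomial.C (yv n m ℓ)) =
    y * ((t ^ a * u ^ b : Sˣ) : S) := by
  rw [torusChange, laurentLift_C, lift_yv]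

theorem torusChange_C_zv : torusChange h u p q r s a b h1 h2 (LaurentPolynomial.C (zv n m ℓ)) =
    z * (((t ^ a * u ^ b) ^ m : Sˣ) : S) := by
  rw [torusChange, laurentLift_C, lift_zv]

theorem torusChange_C_tv : torusChange h u p q r s a b h1 h2 (LaurentPolynomial.C (tv n m ℓ)) =
    ((t ^ p * u ^ q : Sˣ) : S) := by
  rw [torusChange, laurentLift_C, lift_tv]

theorem torusChange_T : torusChange h u p q r s a b h1 h2 (LaurentPolynomial.T 1) =
    ((t ^ r * u ^ s : Sˣ) : S) := by
  rw [torusChange, laurentLift_T, zpow_one]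

theorem comp_torusChange {S₂ : Type*} [CommRing S₂] [Algebra ℂ S₂] (f : S →ₐ[ℂ] S₂)
    (g : LaurentPolynomial (negKodairaRing n m ℓ) →ₐ[ℂ] S₂) {t₂ u₂ : S₂ˣ}
    (hd : p * s - q * r = 1)
    (hx : ∀ i, f (x i) = g (LaurentPolynomial.C (xv n m ℓ i)))
    (hy : f y = g (LaurentPolynomial.C (yv n m ℓ)) *
      ((t₂ ^ (-s * a + r * b) * u₂ ^ (q * a - p * b) : S₂ˣ) : S₂))
    (hz : f z = g (LaurentPolynomial.C (zv n m ℓ)) *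
      (((t₂ ^ (-s * a + r * b) * u₂ ^ (q * a - p * b)) ^ m : S₂ˣ) : S₂))
    (ht : f t = ((t₂ ^ s * u₂ ^ (-q) : S₂ˣ) : S₂))
    (hu : f u = ((t₂ ^ (-r) * u₂ ^ p : S₂ˣ) : S₂))
    (ht₂ : g (LaurentPolynomial.C (tv n m ℓ)) = t₂) (hu₂ : g (LaurentPolynomial.T 1) = u₂) :
    f.comp (torusChange h u p q r s a b h1 h2) = g := by
  have Ht : unitsMap f t = t₂ ^ s * u₂ ^ (-q) := Units.ext ht
  have Hu : unitsMap f u = t₂ ^ (-r) * u₂ ^ p := Units.ext hu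
  have key (i j : ℤ) : unitsMap f (t ^ i * u ^ j) =
      t₂ ^ (s * i - r * j) * u₂ ^ (p * j - q * i) := by
    rw [map_mul, map_zpow, map_zpow, Ht, Hu, torus_eval]
    congr 2 <;> ring
  have hone : (t₂ ^ (-s * a + r * b) * u₂ ^ (q * a - p * b)) *
      (t₂ ^ (s * a - r * b) * u₂ ^ (p * b - q * a)) = 1 := by
    rw [torus_mul, show -s * a + r * b + (s * a - r * b) = 0 by ring,
      show q * a - p * b + (p * b - q * a) = 0 by ring, zpow_zero, zpow_zero, mul_one]
  apply laurent_algHom_ext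
  · apply algHom_ext
    · intro i
      simp only [AlgHom.comp_apply, laurentC_apply]
      rw [torusChange_C_xv, hx]
    · simp only [AlgHom.comp_apply, laurentC_apply]
      rw [torusChange_C_yv, map_mul, hy, ← val_unitsMap, key, mul_assoc, ← Units.val_mul, hone,
        Units.val_one, mul_one]
    · simp only [AlgHom.comp_apply, laurentC_apply]
      rw [torusChange_C_zv, map_mul, hz, ← val_unitsMap, map_pow, key, mul_assoc, ← Units.val_mul,
        ← mul_pow, hone, one_pow, Units.val_one, mul_one]
    · simp only [AlgHom.comp_apply, laurentC_apply]
      rw [torusChange_C_tv, ← val_unitsMap, key, ht₂, show s * p - r * q = 1 by linarith,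
        show p * q - q * p = 0 by ring, zpow_zero, zpow_one, mul_one]
  · rw [AlgHom.comp_apply, torusChange_T, ← val_unitsMap, key, hu₂,
      show s * r - r * s = 0 by ring, show p * s - q * r = 1 by linarith, zpow_zero, zpow_one,
      one_mul]

end

theorem relation_laurent {ℓ : ℕ} (hℓ : 1 ≤ ℓ) :
    (∏ i, LaurentPolynomial.C (xv n m ℓ i)) ^ 2 * LaurentPolynomial.C (zv n m ℓ) =
      LaurentPolynomial.C (yv n m ℓ) ^ m +
      ((tL n m hℓ ^ (-(ℓ : ℤ)) : (LaurentPolynomial (negKodairaRing n m ℓ))ˣ) :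
        LaurentPolynomial (negKodairaRing n m ℓ)) := by
  rw [tL, ← map_val_zpow, laurentC_apply, ← map_prod, ← map_pow, ← map_pow, ← map_mul, ← map_add,
    relation hℓ]

theorem nonempty_laurent_algEquiv {ℓ ℓ' : ℕ} (hℓ : 1 ≤ ℓ) (hℓ' : 1 ≤ ℓ')
    (hcop : Nat.gcd ℓ m = 1) (hcop' : Nat.gcd ℓ' m = 1) :
    Nonempty (LaurentPolynomial (negKodairaRing n m ℓ) ≃ₐ[ℂ]
      LaurentPolynomial (negKodairaRing n m ℓ')) := by
  have hc : IsCoprime (ℓ : ℤ) m := Nat.isCoprime_iff_coprime.2 hcop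
  have hc' : IsCoprime (ℓ' : ℤ) m := Nat.isCoprime_iff_coprime.2 hcop'
  obtain ⟨e, f, hef⟩ := id hc
  obtain ⟨p, a, h1⟩ : ∃ p a : ℤ, p * ℓ + m * a = ℓ' :=
    ⟨ℓ' * e, ℓ' * f, by linear_combination (ℓ' : ℤ) * hef⟩
  have hpm : IsCoprime p (m : ℤ) := by
    have : IsCoprime (p * ℓ) (m : ℤ) := by
      rw [show p * (ℓ : ℤ) = ℓ' + m * (-a) by linarith]
      exact hc'.add_mul_left_left _
    exact this.of_mul_left_left
  obtain ⟨s, r, hd⟩ := hpm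
  have h2 : (m : ℤ) * ℓ + m * (-ℓ) = 0 := by ring
  have hd1 : p * s - m * (-r) = 1 := by linarith
  have h1' : s * ℓ' + m * (-s * a + (-r) * (-ℓ)) = (ℓ : ℤ) := by
    linear_combination (-s) * h1 + ℓ * hd
  have h2' : (-(m : ℤ)) * ℓ' + m * ((m : ℤ) * a - p * (-ℓ)) = 0 := by
    linear_combination (m : ℤ) * h1
  have hya : -p * (-s * a + (-r) * (-ℓ)) + r * ((m : ℤ) * a - p * (-ℓ)) = a := by
    linear_combination a * hd
  have hyb : -(m : ℤ) * (-s * a + (-r) * (-ℓ)) - s * ((m : ℤ) * a - p * (-ℓ)) = -ℓ := by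
    linear_combination (-(ℓ : ℤ)) * hd
  refine ⟨AlgEquiv.ofAlgHom
    (torusChange (relation_laurent hℓ') (Tu _) p m (-r) s a (-ℓ) h1 h2)
    (torusChange (relation_laurent hℓ) (Tu _) s (-m) r p _ _ h1' h2') ?_ ?_⟩
  · refine comp_torusChange (relation_laurent hℓ) (Tu _) s (-m) r p _ _ h1' h2' _ (AlgHom.id ℂ _)
      (t₂ := tL n m hℓ') (u₂ := Tu _) (by linear_combination hd) ?_ ?_ ?_ ?_ ?_ rfl rfl
    · exact fun i => torusChange_C_xv ..
    · rw [torusChange_C_yv, hya, hyb]; rfl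
    · rw [torusChange_C_zv, hya, hyb]; rfl
    · rw [neg_neg]; exact torusChange_C_tv ..
    · rw [val_Tu, torusChange_T]
  · refine comp_torusChange (relation_laurent hℓ') (Tu _) p m (-r) s _ _ h1 h2 _ (AlgHom.id ℂ _)
      (t₂ := tL n m hℓ) (u₂ := Tu _) (by linear_combination hd) ?_ ?_ ?_ ?_ ?_ rfl rfl
    · exact fun i => torusChange_C_xv ..
    · exact torusChange_C_yv ..
    · exact torusChange_C_zv ..
    · exact torusChange_C_tv ..
    · rw [val_Tu, torusChange_T, neg_neg]

end LaurentIso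

section LocallyNilpotent

/-- A derivation is locally nilpotent if each element is annihilated by some iterate of it. -/
def IsLND {R : Type*} [CommRing R] [Algebra ℂ R] (D : Derivation ℂ R R) : Prop :=
  ∀ a, ∃ r, D^[r] a = 0

/-- `a` has degree `r` with respect to `D`: `r` is the last exponent with `D^r a ≠ 0`. -/
def HasDeg {R : Type*} [CommRing R] [Algebra ℂ R] (D : Derivation ℂ R R) (a : R) (r : ℕ) : Prop :=
  D^[r] a ≠ 0 ∧ D^[r + 1] a = 0

variable {R : Type*} [CommRing R] [Algebra ℂ R] {D : Derivation ℂ R R}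

theorem iterate_eq_zero_of_le {a : R} {r s : ℕ} (h : D^[r] a = 0) (hrs : r ≤ s) :
    D^[s] a = 0 := by
  obtain ⟨k, rfl⟩ := Nat.exists_eq_add_of_le' hrs
  rw [Function.iterate_add_apply, h, iterate_map_zero]

theorem iterate_mul_eq (N : ℕ) {i j : ℕ} {a b : R} (hN : i + j = N) (ha : D^[i + 1] a = 0)
    (hb : D^[j + 1] b = 0) : D^[N] (a * b) = N.choose i * (D^[i] a * D^[j] b) := by
  induction N generalizing i j a b with
  | zero =>
    obtain ⟨rfl, rfl⟩ : i = 0 ∧ j = 0 := by omega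
    simp
  | succ N ih =>
    rw [Function.iterate_succ_apply, Derivation.leibniz, smul_eq_mul, smul_eq_mul,
      iterate_map_add]
    rcases i with _ | i
    · rcases j with _ | j
      · omega
      have ha' : D a = 0 := ha
      rw [ih (i := 0) (j := j) (by omega) ha (by simpa using hb), ha', mul_zero, iterate_map_zero]
      simp
    · rcases j with _ | j
      · have hb' : D b = 0 := hb
        rw [mul_comm b, ih (i := i) (j := 0) (by omega) (by simpa using ha) hb, hb', mul_zero,
          iterate_map_zero]
        obtain rfl : i = N := by omega
        simp
      · rw [mul_comm b, ih (i := i + 1) (j := j) (by omega) ha (by simpa using hb),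
          ih (i := i) (j := j + 1) (by omega) (by simpa using ha) hb, Nat.choose_succ_succ]
        simp only [← Function.iterate_succ_apply]
        push_cast
        ring

theorem hasDeg_zero_iff {a : R} : HasDeg D a 0 ↔ a ≠ 0 ∧ D a = 0 := Iff.rfl

theorem HasDeg.ne_zero {a : R} {r : ℕ} (h : HasDeg D a r) : a ≠ 0 := by
  rintro rfl
  exact h.1 (iterate_map_zero _ _)

theorem HasDeg.unique {a : R} {r s : ℕ} (h : HasDeg D a r) (h' : HasDeg D a s) : r = s := by
  by_contra hne
  rcases lt_or_gt_of_ne hne with hlt | hlt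
  · exact h'.1 (iterate_eq_zero_of_le h.2 hlt)
  · exact h.1 (iterate_eq_zero_of_le h'.2 hlt)

theorem HasDeg.deriv {a : R} {r : ℕ} (h : HasDeg D a (r + 1)) : HasDeg D (D a) r := h

theorem HasDeg.exists_succ {a : R} {r : ℕ} (h : HasDeg D a r) (ha : D a ≠ 0) : ∃ s, r = s + 1 := by
  rcases r with _ | r
  · exact absurd h.2 ha
  · exact ⟨r, rfl⟩

theorem IsLND.exists_hasDeg (hD : IsLND D) {a : R} (ha : a ≠ 0) : ∃ r, HasDeg D a r := by
  classical
  have h := hD a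
  obtain ⟨r, hr⟩ : ∃ r, Nat.find h = r + 1 :=
    Nat.exists_eq_succ_of_ne_zero fun h0 => ha (by simpa [h0] using Nat.find_spec h)
  exact ⟨r, Nat.find_min h (by omega), hr ▸ Nat.find_spec h⟩

variable [IsDomain R]

theorem HasDeg.mul {a b : R} {r s : ℕ} (ha : HasDeg D a r) (hb : HasDeg D b s) :
    HasDeg D (a * b) (r + s) := by
  have : CharZero R := charZero_of_injective_algebraMap (algebraMap ℂ R).injective
  have h := iterate_mul_eq (r + s) rfl ha.2 hb.2
  refine ⟨?_, ?_⟩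
  · rw [h]
    exact mul_ne_zero (Nat.cast_ne_zero.2 (Nat.choose_pos (by omega)).ne')
      (mul_ne_zero ha.1 hb.1)
  · have ha' : D (D^[r] a) = 0 := (Function.iterate_succ_apply' D r a).symm.trans ha.2
    have hb' : D (D^[s] b) = 0 := (Function.iterate_succ_apply' D s b).symm.trans hb.2
    rw [Function.iterate_succ_apply', h, Derivation.leibniz, Derivation.leibniz, ha', hb']
    simp

theorem HasDeg.pow {a : R} {r : ℕ} (ha : HasDeg D a r) (k : ℕ) : HasDeg D (a ^ k) (k * r) := by
  induction k with
  | zero => simp [hasDeg_zero_iff]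
  | succ k ih => rw [pow_succ, add_mul, one_mul]; exact ih.mul ha

theorem IsLND.map_eq_zero_of_dvd_map (hD : IsLND D) {a : R} (h : a ∣ D a) : D a = 0 := by
  by_contra hne
  obtain ⟨c, hc⟩ := h
  have ha : a ≠ 0 := by rintro rfl; simp at hne
  have hc0 : c ≠ 0 := by rintro rfl; simp [hc] at hne
  obtain ⟨r, hr⟩ := hD.exists_hasDeg ha
  obtain ⟨s, hs⟩ := hD.exists_hasDeg hc0
  obtain ⟨r, rfl⟩ := hr.exists_succ hne
  have := hr.deriv.unique (hc ▸ hr.mul hs)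
  omega

theorem IsLND.map_eq_zero_of_mul (hD : IsLND D) {a b : R} (hab : a * b ≠ 0) (h : D (a * b) = 0) :
    D a = 0 := by
  obtain ⟨r, hr⟩ := hD.exists_hasDeg (left_ne_zero_of_mul hab)
  obtain ⟨s, hs⟩ := hD.exists_hasDeg (right_ne_zero_of_mul hab)
  have := (hr.mul hs).unique (hasDeg_zero_iff.2 ⟨hab, h⟩)
  obtain rfl : r = 0 := by omega
  exact hr.2

theorem IsLND.map_eq_zero_of_isUnit (hD : IsLND D) {a : R} (h : IsUnit a) : D a = 0 := by
  obtain ⟨b, hb⟩ := h.exists_right_inv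
  exact hD.map_eq_zero_of_mul (b := b) (by simp [hb]) (by simp [hb])

theorem IsLND.map_eq_zero_of_relation (hD : IsLND D) {x y z τ : R} {m : ℕ} (hm : 2 ≤ m)
    (hτ : IsUnit τ) (h : x ^ 2 * z = y ^ m + τ) (hz0 : z ≠ 0) (hx0 : x ≠ 0) (hz : z ∣ D z) :
    D y = 0 ∧ D x = 0 := by
  have : CharZero R := charZero_of_injective_algebraMap (algebraMap ℂ R).injective
  replace hz := hD.map_eq_zero_of_dvd_map hz
  have hDτ := hD.map_eq_zero_of_isUnit hτ
  have h' : 2 * x * z * D x = m * y ^ (m - 1) * D y := by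
    have := congrArg D h
    rw [map_add, hDτ, Derivation.leibniz, Derivation.leibniz_pow, Derivation.leibniz_pow, hz] at this
    simp only [smul_eq_mul, nsmul_eq_mul, Nat.cast_ofNat] at this
    linear_combination this
  by_cases hy : D y = 0
  · refine ⟨hy, ?_⟩
    rw [hy, mul_zero] at h'
    exact (mul_eq_zero.1 h').resolve_left (mul_ne_zero (mul_ne_zero two_ne_zero hx0) hz0)
  exfalso
  have hy0 : y ≠ 0 := by rintro rfl; simp at hy
  obtain ⟨a, ha⟩ := hD.exists_hasDeg hx0
  obtain ⟨b, hb⟩ := hD.exists_hasDeg hy0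
  obtain ⟨b, rfl⟩ := hb.exists_succ hy
  have hm0 : (m : R) ≠ 0 := Nat.cast_ne_zero.2 (by omega)
  have e1 : 2 * a + 0 = m * (b + 1) := by
    refine ((ha.pow 2).mul (hasDeg_zero_iff.2 ⟨hz0, hz⟩)).unique ?_
    rw [h]
    have hp := hb.pow m
    have hDk (k : ℕ) : D^[k + 1] τ = 0 := by
      rw [Function.iterate_succ_apply, hDτ, iterate_map_zero]
    obtain ⟨k, hk⟩ : ∃ k, m * (b + 1) = k + 1 :=
      Nat.exists_eq_succ_of_ne_zero (by positivity)
    rw [hk] at hp ⊢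
    refine ⟨?_, ?_⟩
    · rw [iterate_map_add, hDk, add_zero]; exact hp.1
    · rw [iterate_map_add, hDk, add_zero]; exact hp.2
  have e2 : τ * m * D y = x * (z * (m * x * D y - 2 * y * D x)) := by
    have hym : y * y ^ (m - 1) = y ^ m := by rw [← pow_succ', Nat.sub_add_cancel (by omega)]
    linear_combination (-m * D y) * h + y * h' + (m * D y) * hym
  have hne : x * (z * (m * x * D y - 2 * y * D x)) ≠ 0 := by
    rw [← e2]; exact mul_ne_zero (mul_ne_zero hτ.ne_zero hm0) hy
  obtain ⟨c, hc⟩ := hD.exists_hasDeg (right_ne_zero_of_mul hne)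
  have hτm : HasDeg D (τ * m) 0 :=
    hasDeg_zero_iff.2 ⟨mul_ne_zero hτ.ne_zero hm0, by rw [Derivation.leibniz, hDτ]; simp⟩
  have e3 := (ha.mul hc).unique (e2 ▸ hτm.mul hb.deriv)
  have : 2 * (b + 1) ≤ m * (b + 1) := Nat.mul_le_mul_right _ hm
  omega

end LocallyNilpotent

section Model

/-- Linear combinations of a family with coefficients in a ring acting through `f`. -/
noncomputable def linearComb {A R : Type*} [CommRing A] [CommRing R] (f : A →+* R) (e : ℕ → R) :
    (ℕ →₀ A) →+ R :=
  Finsupp.liftAddHom fun N => (AddMonoidHom.mulRight (e N)).comp (f : A →+ R)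

theorem linearComb_single {A R : Type*} [CommRing A] [CommRing R] (f : A →+* R) (e : ℕ → R) (N : ℕ)
    (a : A) : linearComb f e (Finsupp.single N a) = f a * e N := by
  simp [linearComb]

/-- The set of linear combinations of a family. -/
noncomputable def linearSpan {A R : Type*} [CommRing A] [CommRing R] (f : A →+* R) (e : ℕ → R) :
    AddSubgroup R :=
  (linearComb f e).range

theorem mul_mem_linearSpan {A R : Type*} [CommRing A] [CommRing R] {f : A →+* R} {e : ℕ → R} {a : R}
    (h : ∀ N b, a * (f b * e N) ∈ linearSpan f e) (r : R) (hr : r ∈ linearSpan f e) :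
    a * r ∈ linearSpan f e := by
  obtain ⟨c, rfl⟩ := hr
  induction c using Finsupp.induction_linear with
  | zero => rw [map_zero, mul_zero]; exact zero_mem _
  | add f g hf hg => rw [map_add, mul_add]; exact add_mem hf hg
  | single N b => rw [linearComb_single]; exact h N b

open Polynomial in
theorem model_relation {K : Type*} [Field K] {n m ℓ : ℕ} {x : Fin n → K} {t : Kˣ}
    (hx : ∀ i, x i ≠ 0) :
    Polynomial.C (t : K) ^ ℓ * ((∏ i, Polynomial.C (x i)) ^ 2 *
      (Polynomial.C ((∏ i, x i)⁻¹ ^ 2) *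
        ((Polynomial.X : K[X]) ^ m + Polynomial.C (((t ^ (-(ℓ : ℤ)) : Kˣ) : K)))) -
        Polynomial.X ^ m) = 1 := by
  have h0 : ∏ i, x i ≠ 0 := Finset.prod_ne_zero_iff.2 fun i _ => hx i
  have h1 : (∏ i, Polynomial.C (x i)) ^ 2 * Polynomial.C ((∏ i, x i)⁻¹ ^ 2) = 1 := by
    rw [← map_prod, ← map_pow, ← map_mul, ← mul_pow, mul_inv_cancel₀ h0, one_pow, map_one]
  rw [← mul_assoc, h1, one_mul, add_sub_cancel_left, ← map_pow, ← map_mul,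
    ← Units.val_pow_eq_pow_val, ← Units.val_mul, zpow_neg, zpow_natCast, mul_inv_cancel,
    Units.val_one, map_one]

/-- The ring `ℂ[x₁, …, xₙ][t, t⁻¹]`. -/
abbrev Base (n : ℕ) : Type := LaurentPolynomial (MvPolynomial (Fin n) ℂ)

/-- The variable `xᵢ` of the base ring. -/
noncomputable def xb {n : ℕ} (i : Fin n) : Base n := LaurentPolynomial.C (X i)

/-- The product of the variables of the base ring. -/
noncomputable def pb (n : ℕ) : Base n := ∏ i, xb i

variable (n m : ℕ) {ℓ : ℕ} (hℓ : 1 ≤ ℓ)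

/-- The inclusion of the base ring. -/
noncomputable def base : Base n →ₐ[ℂ] negKodairaRing n m ℓ :=
  laurentLift (aeval (xv n m ℓ)) (tu n m hℓ)

@[simp] theorem base_xb (i : Fin n) : base n m hℓ (xb i) = xv n m ℓ i := by
  rw [base, xb, laurentLift_C, aeval_X]

@[simp] theorem base_T (k : ℤ) : base n m hℓ (LaurentPolynomial.T k) =
    ((tu n m hℓ ^ k : (negKodairaRing n m ℓ)ˣ) : negKodairaRing n m ℓ) := by
  rw [base, laurentLift_T]

theorem base_T_one : base n m hℓ (LaurentPolynomial.T 1) = tv n m ℓ := by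
  rw [base_T, zpow_one, val_tu]

theorem base_pb : base n m hℓ (pb n) = ∏ i, xv n m ℓ i := by
  simp only [pb, map_prod, base_xb]

variable {n m}

theorem base_relation : base n m hℓ (pb n ^ 2) * zv n m ℓ =
    yv n m ℓ ^ m + base n m hℓ (LaurentPolynomial.T (-ℓ)) := by
  rw [map_pow, base_pb, base_T, relation hℓ]

variable (n m)

theorem xb_ne_zero {n : ℕ} (i : Fin n) : xb i ≠ 0 := by
  intro h
  have := congrArg (fun p : Base n => p.coeff 0) h
  simp [xb, X_ne_zero] at this

variable {K : Type*} [Field K] [Algebra ℂ K] (κ : Base n →ₐ[ℂ] K) (hκ : Function.Injective κ)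

include hκ in
theorem map_xb_ne_zero (i : Fin n) : κ (xb i) ≠ 0 := (map_ne_zero_iff κ hκ).2 (xb_ne_zero i)

/-- The embedding of `R_{n,m,ℓ}` into a polynomial ring in `y` over a field. -/
noncomputable def model : negKodairaRing n m ℓ →ₐ[ℂ] Polynomial K :=
  lift (fun i => Polynomial.C (κ (xb i))) Polynomial.X
    (Polynomial.C ((∏ i, κ (xb i))⁻¹ ^ 2) * (Polynomial.X ^ m + Polynomial.C
      ((((unitsMap κ (Tu _)) ^ (-(ℓ : ℤ)) : Kˣ) : K))))
    (Polynomial.C ((unitsMap κ (Tu _) : Kˣ) : K))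
    (model_relation (map_xb_ne_zero n κ hκ))

@[simp] theorem model_yv : model n m κ hκ (yv n m ℓ) = Polynomial.X := by
  rw [model, lift_yv]

theorem model_zv : model n m κ hκ (zv n m ℓ) = Polynomial.C ((∏ i, κ (xb i))⁻¹ ^ 2) *
    (Polynomial.X ^ m + Polynomial.C ((((unitsMap κ (Tu _)) ^ (-(ℓ : ℤ)) : Kˣ) : K))) := by
  rw [model, lift_zv]

theorem model_comp_base : (model n m κ hκ).comp (base n m hℓ) =
    (Polynomial.CAlgHom (R := ℂ) (A := K)).comp κ := by
  apply laurent_algHom_ext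
  · apply MvPolynomial.algHom_ext
    intro i
    change model n m κ hκ (base n m hℓ (xb i)) = Polynomial.C (κ (xb i))
    rw [base_xb, model, lift_xv]
  · change model n m κ hκ (base n m hℓ _) = Polynomial.C (κ _)
    rw [base_T_one, model, lift_tv]
    rfl

@[simp] theorem model_base (a : Base n) :
    model n m κ hκ (base n m hℓ a) = Polynomial.C (κ a) :=
  DFunLike.congr_fun (model_comp_base n m hℓ κ hκ) a

variable (ℓ) in
/-- A basis of `R_{n,m,ℓ}` over the base ring, indexed by the degree in `y`. -/
noncomputable def basisElem (N : ℕ) : negKodairaRing n m ℓ :=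
  yv n m ℓ ^ (N % m) * zv n m ℓ ^ (N / m)

/-- Linear combinations of the basis elements. -/
noncomputable def comb : (ℕ →₀ Base n) →+ negKodairaRing n m ℓ :=
  linearComb (base n m hℓ).toRingHom (basisElem n m ℓ)

theorem comb_single (N : ℕ) (b : Base n) :
    comb n m hℓ (Finsupp.single N b) = base n m hℓ b * basisElem n m ℓ N :=
  linearComb_single ..

theorem comb_apply (c : ℕ →₀ Base n) :
    comb n m hℓ c = c.sum fun N b => base n m hℓ b * basisElem n m ℓ N := rfl

variable {m}

theorem yv_mul_basisElem_mem (hm : 1 ≤ m) (N : ℕ) (b : Base n) :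
    yv n m ℓ * (base n m hℓ b * basisElem n m ℓ N) ∈
      linearSpan (base n m hℓ).toRingHom (basisElem n m ℓ) := by
  rcases Nat.lt_or_ge (N % m + 1) m with h | h
  · refine ⟨Finsupp.single (N + 1) b, ?_⟩
    have h1 : (N + 1) % m = N % m + 1 := by
      rw [Nat.add_mod, Nat.mod_eq_of_lt (by omega : 1 < m), Nat.mod_eq_of_lt h]
    have h2 : (N + 1) / m = N / m := by
      have e1 := Nat.div_add_mod (N + 1) m
      have e2 := Nat.div_add_mod N m
      exact Nat.eq_of_mul_eq_mul_left (by omega : 0 < m) (by omega)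
    refine (comb_single ..).trans ?_
    rw [basisElem, basisElem, h1, h2]
    ring
  · have hlt := Nat.mod_lt N (by omega : 0 < m)
    have e2 := Nat.div_add_mod N m
    have e : N % m + 1 = m := by omega
    have hy : yv n m ℓ * yv n m ℓ ^ (N % m) = yv n m ℓ ^ m := by rw [← pow_succ', e]
    have key : yv n m ℓ * (base n m hℓ b * basisElem n m ℓ N) =
        base n m hℓ (b * pb n ^ 2) * basisElem n m ℓ (m * (N / m + 1)) -
          base n m hℓ (b * LaurentPolynomial.T (-ℓ)) * basisElem n m ℓ (m * (N / m)) := by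
      rw [basisElem, basisElem, basisElem, Nat.mul_mod_right, Nat.mul_mod_right,
        Nat.mul_div_cancel_left _ (by omega), Nat.mul_div_cancel_left _ (by omega), map_mul,
        map_mul]
      linear_combination base n m hℓ b * zv n m ℓ ^ (N / m) * hy -
        (base n m hℓ b * zv n m ℓ ^ (N / m)) * (base_relation (n := n) (m := m) hℓ)
    rw [key]
    exact sub_mem ⟨_, linearComb_single ..⟩ ⟨_, linearComb_single ..⟩

theorem comb_surjective (hm : 1 ≤ m) : Function.Surjective (comb n m hℓ) := by
  have key (a : negKodairaRing n m ℓ) :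
      ∀ r ∈ linearSpan (base n m hℓ).toRingHom (basisElem n m ℓ),
        a * r ∈ linearSpan (base n m hℓ).toRingHom (basisElem n m ℓ) := by
    induction a using induction with
    | hx i => exact mul_mem_linearSpan fun N b => ⟨Finsupp.single N (xb i * b),
        (comb_single ..).trans (by rw [map_mul, base_xb, mul_assoc]; rfl)⟩
    | hy => exact mul_mem_linearSpan fun N b => yv_mul_basisElem_mem n hℓ hm N b
    | hz =>
      refine mul_mem_linearSpan fun N b =>
        ⟨Finsupp.single (N + m) b, (comb_single ..).trans ?_⟩
      rw [basisElem, basisElem, Nat.add_mod_right, Nat.add_div_right _ (by omega), pow_succ]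
      change _ = zv n m ℓ * (base n m hℓ b * _)
      ring
    | ht => exact mul_mem_linearSpan fun N b => ⟨Finsupp.single N (LaurentPolynomial.T 1 * b),
        (comb_single ..).trans (by rw [map_mul, base_T_one, mul_assoc]; rfl)⟩
    | hC r => exact mul_mem_linearSpan fun N b => ⟨Finsupp.single N (algebraMap ℂ _ r * b),
        (comb_single ..).trans (by rw [map_mul, AlgHom.commutes, mul_assoc]; rfl)⟩
    | hadd a b ha hb => exact fun r hr => by rw [add_mul]; exact add_mem (ha r hr) (hb r hr)
    | hmul a b ha hb => exact fun r hr => by rw [mul_assoc]; exact ha _ (hb r hr)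
  intro a
  have h1 : comb n m hℓ (Finsupp.single 0 1) = 1 := by simp [comb_single, basisElem]
  have := key a 1 ⟨_, h1⟩
  rwa [mul_one] at this

theorem natDegree_model_basisElem (hm : 1 ≤ m) (N : ℕ) :
    (model n m κ hκ (basisElem n m ℓ N)).natDegree = N ∧
      model n m κ hκ (basisElem n m ℓ N) ≠ 0 := by
  have h0 : (∏ i, κ (xb i))⁻¹ ^ 2 ≠ 0 :=
    pow_ne_zero _ (inv_ne_zero (Finset.prod_ne_zero_iff.2 fun i _ => map_xb_ne_zero n κ hκ i))
  have hz : model n m κ hκ (zv n m ℓ) ≠ 0 := by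
    rw [model_zv]
    exact mul_ne_zero (Polynomial.C_ne_zero.2 h0) (Polynomial.X_pow_add_C_ne_zero (by omega) _)
  rw [basisElem, map_mul, map_pow, map_pow, model_yv]
  refine ⟨?_, mul_ne_zero (pow_ne_zero _ Polynomial.X_ne_zero) (pow_ne_zero _ hz)⟩
  rw [Polynomial.natDegree_mul (pow_ne_zero _ Polynomial.X_ne_zero) (pow_ne_zero _ hz),
    Polynomial.natDegree_pow, Polynomial.natDegree_pow, model_zv, Polynomial.natDegree_C_mul h0,
    Polynomial.natDegree_X_pow_add_C, Polynomial.natDegree_X, mul_one, Nat.mod_add_div']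

include hκ in
theorem comb_support_le (hm : 1 ≤ m) {c : ℕ →₀ Base n} {k : ℕ}
    (h : ∀ N, k < N → (model n m κ hκ (comb n m hℓ c)).coeff N = 0) {N : ℕ}
    (hN : k < N) : c N = 0 := by
  by_contra hne
  have hs : c.support.Nonempty := ⟨N, Finsupp.mem_support_iff.2 hne⟩
  set d := c.support.max' hs with hd
  have hdm : d ∈ c.support := Finset.max'_mem _ _
  have hNd : N ≤ d := Finset.le_max' _ _ (Finsupp.mem_support_iff.2 hne)
  have h' := h d (by omega)
  rw [comb_apply, map_finsuppSum, Finsupp.sum, Polynomial.finsetSum_coeff,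
    Finset.sum_eq_single d] at h'
  · obtain ⟨e1, e2⟩ := natDegree_model_basisElem n (ℓ := ℓ) κ hκ hm d
    rw [map_mul, model_base, Polynomial.coeff_C_mul, mul_eq_zero, map_eq_zero_iff κ hκ] at h'
    rcases h' with h' | h'
    · exact Finsupp.mem_support_iff.1 hdm h'
    · nth_rewrite 2 [← e1] at h'
      exact e2 (Polynomial.leadingCoeff_eq_zero.1 h')
  · intro b hb hbd
    rw [map_mul, model_base, Polynomial.coeff_C_mul, Polynomial.coeff_eq_zero_of_natDegree_lt,
      mul_zero]
    rw [(natDegree_model_basisElem n (ℓ := ℓ) κ hκ hm b).1]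
    exact lt_of_le_of_ne (Finset.le_max' _ _ hb) hbd
  · exact fun h => absurd hdm h

include hℓ in
theorem model_injective (hm : 1 ≤ m) :
    Function.Injective (model (ℓ := ℓ) n m κ hκ) := by
  rw [injective_iff_map_eq_zero]
  intro a ha
  obtain ⟨c, rfl⟩ := comb_surjective n hℓ hm a
  have h1 (N : ℕ) (hN : 0 < N) : c N = 0 :=
    comb_support_le n hℓ κ hκ hm (k := 0) (fun N _ => by rw [ha, Polynomial.coeff_zero]) hN
  have h2 : c = Finsupp.single 0 (c 0) := by
    ext1 N
    rcases N with _ | N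
    · simp
    · simp [h1]
  rw [h2, comb_single, basisElem, Nat.zero_mod, Nat.zero_div, pow_zero, pow_zero, one_mul,
    mul_one, model_base, Polynomial.C_eq_zero, map_eq_zero_iff κ hκ] at ha
  rw [h2, ha, Finsupp.single_zero, map_zero]

theorem exists_base_add_of_natDegree_le (hm : 2 ≤ m) {a : negKodairaRing n m ℓ}
    (ha : (model n m κ hκ a).natDegree ≤ 1) :
    ∃ f g, a = base n m hℓ f + base n m hℓ g * yv n m ℓ := by
  obtain ⟨c, rfl⟩ := comb_surjective n hℓ (by omega : 1 ≤ m) a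
  have h1 (N : ℕ) (hN : 1 < N) : c N = 0 :=
    comb_support_le n hℓ κ hκ (by omega) (k := 1)
      (fun N hN => Polynomial.coeff_eq_zero_of_natDegree_lt (ha.trans_lt hN)) hN
  have h2 : c = Finsupp.single 0 (c 0) + Finsupp.single 1 (c 1) := by
    ext1 N
    rcases N with _ | _ | N
    · simp
    · simp
    · simp [h1]
  refine ⟨c 0, c 1, ?_⟩
  nth_rewrite 1 [h2]
  rw [map_add, comb_single, comb_single]
  simp [basisElem, Nat.mod_eq_of_lt hm, Nat.div_eq_of_lt hm]

theorem exists_base_of_natDegree_eq_zero (hm : 2 ≤ m) {a : negKodairaRing n m ℓ}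
    (ha : (model n m κ hκ a).natDegree = 0) : ∃ f, a = base n m hℓ f := by
  obtain ⟨f, g, rfl⟩ := exists_base_add_of_natDegree_le n hℓ κ hκ hm (a := a) (by omega)
  refine ⟨f, ?_⟩
  have := Polynomial.coeff_eq_zero_of_natDegree_lt (ha.trans_lt Nat.zero_lt_one)
  rw [map_add, map_mul, model_base, model_base, model_yv] at this
  simp only [Polynomial.coeff_add, Polynomial.coeff_C_succ, zero_add,
    Polynomial.coeff_C_mul, Polynomial.coeff_X_one, mul_one] at this
  rw [(map_eq_zero_iff κ hκ).1 this, map_zero, zero_mul, add_zero]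

theorem base_injective : Function.Injective (base n m hℓ) := by
  let κ := IsScalarTower.toAlgHom ℂ (Base n) (FractionRing (Base n))
  have hκ : Function.Injective κ := IsFractionRing.injective _ _
  have h : Function.Injective ((model n m κ hκ).comp (base n m hℓ)) := by
    rw [model_comp_base]
    exact Polynomial.C_injective.comp hκ
  exact Function.Injective.of_comp h

include hℓ in
theorem isDomain (hm : 1 ≤ m) : IsDomain (negKodairaRing n m ℓ) := by
  let κ := IsScalarTower.toAlgHom ℂ (Base n) (FractionRing (Base n))
  have hκ : Function.Injective κ := IsFractionRing.injective _ _
  exact (model_injective n hℓ κ hκ hm).isDomain (model n m κ hκ).toRingHom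

variable (m) in
/-- The evaluation at `y` of polynomials with coefficients in the base ring. -/
noncomputable def evalY : Polynomial (Base n) →+* negKodairaRing n m ℓ :=
  Polynomial.eval₂RingHom (base n m hℓ).toRingHom (yv n m ℓ)

theorem evalY_C (b : Base n) : evalY n m hℓ (Polynomial.C b) = base n m hℓ b :=
  Polynomial.eval₂_C _ _

theorem evalY_X : evalY n m hℓ Polynomial.X = yv n m ℓ := Polynomial.eval₂_X _ _

theorem model_evalY (p : Polynomial (Base n)) :
    model n m κ hκ (evalY n m hℓ p) = p.map (κ : Base n →+* K) := by
  suffices (model n m κ hκ : negKodairaRing n m ℓ →ₐ[ℂ] Polynomial K).toRingHom.comp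
      (evalY n m hℓ) = Polynomial.mapRingHom (κ : Base n →+* K) from DFunLike.congr_fun this p
  refine Polynomial.ringHom_ext (fun b => ?_) ?_
  · simp [evalY_C]
  · simp [evalY_X]

theorem evalY_injective : Function.Injective (evalY n m hℓ) := by
  let κ := IsScalarTower.toAlgHom ℂ (Base n) (FractionRing (Base n))
  have hκ : Function.Injective κ := IsFractionRing.injective _ _
  intro p q h
  have := congrArg (model n m κ hκ) h
  rw [model_evalY, model_evalY] at this
  exact Polynomial.map_injective _ hκ this

theorem exists_pow_mul_eq_evalY (a : negKodairaRing n m ℓ) :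
    ∃ N p, base n m hℓ (pb n) ^ N * a = evalY n m hℓ p := by
  induction a using induction with
  | hx i => exact ⟨0, Polynomial.C (xb i), by rw [evalY_C, base_xb, pow_zero, one_mul]⟩
  | hy => exact ⟨0, Polynomial.X, by rw [evalY_X, pow_zero, one_mul]⟩
  | hz => exact ⟨2, Polynomial.X ^ m + Polynomial.C (LaurentPolynomial.T (-ℓ)), by
      rw [map_add, map_pow, evalY_X, evalY_C, ← map_pow, base_relation]⟩
  | ht => exact ⟨0, Polynomial.C (LaurentPolynomial.T 1), by
      rw [evalY_C, base_T_one, pow_zero, one_mul]⟩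
  | hC r => exact ⟨0, Polynomial.C (algebraMap ℂ _ r), by
      rw [evalY_C, AlgHom.commutes, pow_zero, one_mul]⟩
  | hadd a b ha hb =>
    obtain ⟨N, p, hp⟩ := ha
    obtain ⟨M, q, hq⟩ := hb
    refine ⟨N + M, Polynomial.C (pb n) ^ M * p + Polynomial.C (pb n) ^ N * q, ?_⟩
    rw [map_add, map_mul, map_mul, map_pow, map_pow, evalY_C, ← hp, ← hq]
    ring
  | hmul a b ha hb =>
    obtain ⟨N, p, hp⟩ := ha
    obtain ⟨M, q, hq⟩ := hb
    refine ⟨N + M, p * q, ?_⟩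
    rw [map_mul, ← hp, ← hq]
    ring

end Model

section LaurentDerivation

variable {R : Type*} [CommRing R] [Algebra ℂ R]

omit [Algebra ℂ R] in
theorem coeff_mul_T (f : LaurentPolynomial R) (j i : ℤ) :
    (f * LaurentPolynomial.T j).coeff i = f.coeff (i - j) := by
  have := AddMonoidAlgebra.coeff_mul_single_eq_coeff_mul (x := f) (r := (1 : R)) (m := j)
    (m₁ := i) (i - j) (fun _ _ => by omega)
  rwa [mul_one] at this

omit [Algebra ℂ R] in
theorem coeff_C_mul (a : R) (f : LaurentPolynomial R) (i : ℤ) :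
    (LaurentPolynomial.C a * f).coeff i = a * f.coeff i :=
  AddMonoidAlgebra.coeff_single_zero_mul ..

omit [Algebra ℂ R] in
theorem coeff_C_mul_T (a : R) (j i : ℤ) :
    (LaurentPolynomial.C a * LaurentPolynomial.T j).coeff i = if i = j then a else 0 := by
  rw [coeff_mul_T, LaurentPolynomial.C_apply]
  simp only [sub_eq_zero]

theorem algebraMap_mul_eq (c : ℂ) (f : LaurentPolynomial R) :
    c • f = LaurentPolynomial.C (algebraMap ℂ R c) * f := by
  rw [Algebra.smul_def]; rfl

/-- The derivation of a Laurent polynomial ring acting on the coefficients. -/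
noncomputable def laurentD (D : Derivation ℂ R R) :
    Derivation ℂ (LaurentPolynomial R) (LaurentPolynomial R) :=
  Derivation.mk'
    { toFun := AddMonoidAlgebra.map (D : R →+ R)
      map_add' := AddMonoidAlgebra.map_add _
      map_smul' := fun c f => by ext i; simp }
    (fun f g => by
      change AddMonoidAlgebra.map _ _ = f * AddMonoidAlgebra.map _ g +
        g * AddMonoidAlgebra.map _ f
      have hs (a : R) (k : ℤ) : AddMonoidAlgebra.map (D : R →+ R)
          (LaurentPolynomial.C a * LaurentPolynomial.T k) =
          LaurentPolynomial.C (D a) * LaurentPolynomial.T k := by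
        rw [← LaurentPolynomial.single_eq_C_mul_T, ← LaurentPolynomial.single_eq_C_mul_T,
          AddMonoidAlgebra.map_single]
        rfl
      induction f using LaurentPolynomial.induction_on' with
      | add f₁ f₂ h₁ h₂ => rw [add_mul, AddMonoidAlgebra.map_add, AddMonoidAlgebra.map_add, h₁, h₂]; ring
      | C_mul_T i a =>
        induction g using LaurentPolynomial.induction_on' with
        | add g₁ g₂ h₁ h₂ =>
          rw [mul_add, AddMonoidAlgebra.map_add, AddMonoidAlgebra.map_add, h₁, h₂]; ring
        | C_mul_T j b =>
          rw [mul_mul_mul_comm, ← map_mul, ← LaurentPolynomial.T_add, hs, hs, hs,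
            Derivation.leibniz, smul_eq_mul, smul_eq_mul, map_add, map_mul, map_mul,
            LaurentPolynomial.T_add]
          ring)

theorem laurentD_C_mul_T (D : Derivation ℂ R R) (a : R) (k : ℤ) :
    laurentD D (LaurentPolynomial.C a * LaurentPolynomial.T k) =
      LaurentPolynomial.C (D a) * LaurentPolynomial.T k := by
  change AddMonoidAlgebra.map _ _ = _
  rw [← LaurentPolynomial.single_eq_C_mul_T, ← LaurentPolynomial.single_eq_C_mul_T,
    AddMonoidAlgebra.map_single]
  rfl

theorem IsLND.laurentD {D : Derivation ℂ R R} (hD : IsLND D) : IsLND (laurentD D) := by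
  intro f
  induction f using LaurentPolynomial.induction_on' with
  | add f g hf hg =>
    obtain ⟨r, hr⟩ := hf
    obtain ⟨s, hs⟩ := hg
    exact ⟨r + s, by rw [iterate_map_add, iterate_eq_zero_of_le hr (by omega),
      iterate_eq_zero_of_le hs (by omega), add_zero]⟩
  | C_mul_T k a =>
    obtain ⟨r, hr⟩ := hD a
    have h (s : ℕ) : (NegKodaira.laurentD D)^[s] (LaurentPolynomial.C a * LaurentPolynomial.T k) =
        LaurentPolynomial.C (D^[s] a) * LaurentPolynomial.T k := by
      induction s with
      | zero => rfl
      | succ s ih => rw [Function.iterate_succ_apply', ih, laurentD_C_mul_T,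
          Function.iterate_succ_apply']
    exact ⟨r, by rw [h, hr, map_zero, zero_mul]⟩

/-- The transport of a derivation along an isomorphism. -/
noncomputable def conjD {S : Type*} [CommRing S] [Algebra ℂ S] (E : Derivation ℂ R R)
    (Φ : R →ₐ[ℂ] S) (Ψ : S →ₐ[ℂ] R) (h : ∀ f, Φ (Ψ f) = f) : Derivation ℂ S S :=
  Derivation.mk' (Φ.toLinearMap ∘ₗ (E : R →ₗ[ℂ] R) ∘ₗ Ψ.toLinearMap) (fun a b => by
    change Φ (E (Ψ (a * b))) = a * Φ (E (Ψ b)) + b * Φ (E (Ψ a))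
    rw [map_mul, Derivation.leibniz, smul_eq_mul, smul_eq_mul, map_add, map_mul, map_mul, h, h])

theorem conjD_apply {S : Type*} [CommRing S] [Algebra ℂ S] (E : Derivation ℂ R R)
    (Φ : R →ₐ[ℂ] S) (Ψ : S →ₐ[ℂ] R) (h : ∀ f, Φ (Ψ f) = f) (f : S) :
    conjD E Φ Ψ h f = Φ (E (Ψ f)) := rfl

theorem IsLND.conjD {S : Type*} [CommRing S] [Algebra ℂ S] {E : Derivation ℂ R R} (hE : IsLND E)
    (Φ : R →ₐ[ℂ] S) (Ψ : S →ₐ[ℂ] R) (h : ∀ f, Φ (Ψ f) = f) (h' : ∀ f, Ψ (Φ f) = f) :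
    IsLND (conjD E Φ Ψ h) := by
  intro f
  obtain ⟨r, hr⟩ := hE (Ψ f)
  have key (s : ℕ) : (NegKodaira.conjD E Φ Ψ h)^[s] f = Φ (E^[s] (Ψ f)) := by
    induction s with
    | zero => exact (h f).symm
    | succ s ih => rw [Function.iterate_succ_apply', ih, conjD_apply, h',
        Function.iterate_succ_apply']
  exact ⟨r, by rw [key, hr, map_zero]⟩

variable (Δ : Derivation ℂ (LaurentPolynomial R) (LaurentPolynomial R))

/-- The component of degree `k` of a derivation of a Laurent polynomial ring. -/
noncomputable def componentD (k : ℤ) : Derivation ℂ R R :=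
  Derivation.mk'
    { toFun := fun a => (Δ (LaurentPolynomial.C a)).coeff k
      map_add' := fun a b => by rw [map_add, map_add]; rfl
      map_smul' := fun c a => by
        have : LaurentPolynomial.C (c • a) = c • (LaurentPolynomial.C a : LaurentPolynomial R) := by
          rw [algebraMap_mul_eq, ← map_mul, Algebra.smul_def]
        rw [this, Derivation.map_smul, AddMonoidAlgebra.coeff_smul]; rfl }
    (fun a b => by
      change (Δ _).coeff k = a * (Δ _).coeff k + b * (Δ _).coeff k
      rw [map_mul, Derivation.leibniz, smul_eq_mul, smul_eq_mul, ← coeff_C_mul, ← coeff_C_mul]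
      rfl)

theorem componentD_apply (k : ℤ) (a : R) :
    componentD Δ k a = (Δ (LaurentPolynomial.C a)).coeff k := rfl

variable {Δ}

theorem coeff_derivation (hT : ∀ k, Δ (LaurentPolynomial.T k) = 0) (f : LaurentPolynomial R)
    (j : ℤ) : (Δ f).coeff j = f.coeff.sum fun i b => componentD Δ (j - i) b := by
  induction f using LaurentPolynomial.induction_on' with
  | add f g hf hg =>
    rw [map_add, AddMonoidAlgebra.coeff_add, AddMonoidAlgebra.coeff_add, Finsupp.add_apply, hf, hg,
      Finsupp.sum_add_index' (fun _ => map_zero _) (fun _ _ _ => map_add _ _ _)]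
  | C_mul_T k a =>
    have h1 : (LaurentPolynomial.C a * LaurentPolynomial.T k).coeff = Finsupp.single k a := by
      rw [← LaurentPolynomial.single_eq_C_mul_T]; rfl
    rw [h1, Finsupp.sum_single_index (h := fun i b => componentD Δ (j - i) b) (map_zero _), Derivation.leibniz, hT, smul_zero, zero_add,
      smul_eq_mul, mul_comm, coeff_mul_T, componentD_apply]

theorem coeff_derivation_of_low (hT : ∀ k, Δ (LaurentPolynomial.T k) = 0) {k s : ℤ}
    (hk : ∀ j < k, componentD Δ j = 0) {f : LaurentPolynomial R} (hf : ∀ j < s, f.coeff j = 0) :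
    (∀ j < s + k, (Δ f).coeff j = 0) ∧ (Δ f).coeff (s + k) = componentD Δ k (f.coeff s) := by
  constructor
  · intro j hj
    rw [coeff_derivation hT]
    refine Finset.sum_eq_zero fun i hi => ?_
    have : s ≤ i := by
      by_contra h
      exact Finsupp.mem_support_iff.1 hi (hf i (by omega))
    change componentD Δ (j - i) (f.coeff i) = 0
    rw [hk _ (by omega), Derivation.zero_apply]
  · rw [coeff_derivation hT, Finsupp.sum, Finset.sum_eq_single s]
    · rw [add_sub_cancel_left]
    · intro i hi his
      have : s ≤ i := by
        by_contra h
        exact Finsupp.mem_support_iff.1 hi (hf i (by omega))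
      rw [hk _ (by omega), Derivation.zero_apply]
    · intro hs
      rw [Finsupp.notMem_support_iff.1 hs, map_zero]

/-- The lowest component of a locally nilpotent derivation is locally nilpotent. -/
theorem IsLND.componentD (hΔ : IsLND Δ) (hT : ∀ k, Δ (LaurentPolynomial.T k) = 0) {k : ℤ}
    (hk : ∀ j < k, componentD Δ j = 0) : IsLND (componentD Δ k) := by
  intro a
  have key (r : ℕ) : (∀ j < r * k, (Δ^[r] (LaurentPolynomial.C a)).coeff j = 0) ∧
      (Δ^[r] (LaurentPolynomial.C a)).coeff (r * k) = (NegKodaira.componentD Δ k)^[r] a := by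
    induction r with
    | zero =>
      simp only [Nat.cast_zero, zero_mul, Function.iterate_zero, id]
      exact ⟨fun j hj => by rw [LaurentPolynomial.C_apply, if_neg hj.ne],
        by rw [LaurentPolynomial.C_apply, if_pos rfl]⟩
    | succ r ih =>
      have := coeff_derivation_of_low hT hk ih.1
      rw [ih.2] at this
      rw [Function.iterate_succ_apply', Function.iterate_succ_apply', Nat.cast_add, Nat.cast_one,
        add_mul, one_mul]
      exact this
  obtain ⟨r, hr⟩ := hΔ (LaurentPolynomial.C a)
  exact ⟨r, by rw [← (key r).2, hr]; rfl⟩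

omit [Algebra ℂ R] in
theorem eventually_coeff_eq_zero (f : LaurentPolynomial R) :
    ∀ᶠ j in Filter.atBot, f.coeff j = 0 := by
  induction f using LaurentPolynomial.induction_on' with
  | add f g hf hg =>
    filter_upwards [hf, hg] with j h1 h2
    rw [AddMonoidAlgebra.coeff_add, Finsupp.add_apply, h1, h2, add_zero]
  | C_mul_T k a =>
    filter_upwards [Filter.eventually_lt_atBot k] with j hj
    rw [coeff_C_mul_T, if_neg hj.ne]

end LaurentDerivation

section Grading

theorem dvd_coeff_mul {R : Type*} [CommRing R] {I : ℤ → Prop} (hI : ∀ i j, I (i + j) → I i ∨ I j)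
    {a : R} {f g : LaurentPolynomial R} (hf : ∀ i, I i → a ∣ f.coeff i)
    (hg : ∀ i, I i → a ∣ g.coeff i) (k : ℤ) (hk : I k) : a ∣ (f * g).coeff k := by
  rw [AddMonoidAlgebra.coeff_mul]
  refine Finset.dvd_sum fun i _ => Finset.dvd_sum fun j _ => ?_
  change a ∣ if i + j = k then f.coeff i * g.coeff j else 0
  split_ifs with h
  · rcases hI i j (h ▸ hk) with h' | h'
    · exact (hf i h').mul_right _
    · exact (hg j h').mul_left _
  · exact dvd_zero a

theorem grading_relation {R : Type*} [CommRing R] {n m ℓ : ℕ} {x : Fin n → R} {y z t : R}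
    (h : t ^ ℓ * ((∏ i, x i) ^ 2 * z - y ^ m) = 1) (i : Fin n) (w : ℤ) :
    LaurentPolynomial.C t ^ ℓ *
      ((∏ j, LaurentPolynomial.C (x j) * LaurentPolynomial.T (if j = i then w else 0)) ^ 2 *
        (LaurentPolynomial.C z * LaurentPolynomial.T (-(2 * w))) - LaurentPolynomial.C y ^ m) =
      1 := by
  have hT : ∏ j, (LaurentPolynomial.T (if j = i then w else 0) : LaurentPolynomial R) =
      LaurentPolynomial.T w := by
    rw [Finset.prod_eq_single i, if_pos rfl]
    · intro j _ hj
      rw [if_neg hj, LaurentPolynomial.T_zero]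
    · simp
  have hT2 : (LaurentPolynomial.T w : LaurentPolynomial R) ^ 2 * LaurentPolynomial.T (-(2 * w)) =
      1 := by
    rw [LaurentPolynomial.T_pow, ← LaurentPolynomial.T_add, ← LaurentPolynomial.T_zero]
    congr 1
    push_cast
    ring
  have hC := congrArg (LaurentPolynomial.C : R →+* LaurentPolynomial R) h
  rw [map_mul, map_pow, map_sub, map_mul, map_pow, map_pow, map_prod, map_one] at hC
  rw [Finset.prod_mul_distrib, hT, mul_pow, mul_mul_mul_comm, hT2, mul_one, hC]

theorem map_relation {R S : Type*} [CommRing R] [CommRing S] [Algebra ℂ R] [Algebra ℂ S]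
    (f : R ≃ₐ[ℂ] S) {n m ℓ : ℕ} {x : Fin n → R} {y z t : R}
    (h : t ^ ℓ * ((∏ i, x i) ^ 2 * z - y ^ m) = 1) :
    f t ^ ℓ * ((∏ i, f (x i)) ^ 2 * f z - f y ^ m) = 1 := by
  rw [← map_prod, ← map_pow, ← map_pow, ← map_pow, ← map_mul, ← map_sub, ← map_mul, h, map_one]

variable {n m ℓ : ℕ} {R : Type*} [CommRing R] [Algebra ℂ R] (e : negKodairaRing n m ℓ ≃ₐ[ℂ] R)

include e

theorem equiv_relation :
    e (tv n m ℓ) ^ ℓ * ((∏ i, e (xv n m ℓ i)) ^ 2 * e (zv n m ℓ) - e (yv n m ℓ) ^ m) = 1 :=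
  map_relation e (tv_relation n m ℓ)

theorem equiv_induction {p : R → Prop} (hx : ∀ i, p (e (xv n m ℓ i)))
    (hy : p (e (yv n m ℓ))) (hz : p (e (zv n m ℓ))) (ht : p (e (tv n m ℓ)))
    (hC : ∀ c : ℂ, p (algebraMap ℂ _ c)) (hadd : ∀ a b, p a → p b → p (a + b))
    (hmul : ∀ a b, p a → p b → p (a * b)) (a : R) : p a := by
  obtain ⟨a, rfl⟩ := e.surjective a
  induction a using induction with
  | hx i => exact hx i
  | hy => exact hy
  | hz => exact hz
  | ht => exact ht
  | hC c => rw [AlgEquiv.commutes]; exact hC c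
  | hadd a b ha hb => rw [map_add]; exact hadd _ _ ha hb
  | hmul a b ha hb => rw [map_mul]; exact hmul _ _ ha hb

theorem equiv_algHom_ext {S : Type*} [CommRing S] [Algebra ℂ S] {f g : R →ₐ[ℂ] S}
    (hx : ∀ i, f (e (xv n m ℓ i)) = g (e (xv n m ℓ i)))
    (hy : f (e (yv n m ℓ)) = g (e (yv n m ℓ))) (hz : f (e (zv n m ℓ)) = g (e (zv n m ℓ)))
    (ht : f (e (tv n m ℓ)) = g (e (tv n m ℓ))) : f = g := by
  refine AlgHom.ext fun a => ?_
  induction a using equiv_induction e with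
  | hx i => exact hx i
  | hy => exact hy
  | hz => exact hz
  | ht => exact ht
  | hC c => rw [AlgHom.commutes, AlgHom.commutes]
  | hadd a b ha hb => rw [map_add, map_add, ha, hb]
  | hmul a b ha hb => rw [map_mul, map_mul, ha, hb]

/-- The coaction of the torus for which `xᵢ` has weight `w`, `z` has weight `-2w`, and the other
generators have weight zero. -/
noncomputable def grading (i : Fin n) (w : ℤ) : R →ₐ[ℂ] LaurentPolynomial R :=
  (lift _ _ _ _ (grading_relation (equiv_relation e) i w)).comp e.symm.toAlgHom

theorem grading_apply (i : Fin n) (w : ℤ) (a : negKodairaRing n m ℓ) :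
    grading e i w (e a) = lift _ _ _ _ (grading_relation (equiv_relation e) i w) a :=
  congrArg _ (e.symm_apply_apply a)

theorem grading_xv (i : Fin n) (w : ℤ) (j : Fin n) : grading e i w (e (xv n m ℓ j)) =
    LaurentPolynomial.C (e (xv n m ℓ j)) * LaurentPolynomial.T (if j = i then w else 0) := by
  rw [grading_apply, lift_xv]

theorem grading_yv (i : Fin n) (w : ℤ) :
    grading e i w (e (yv n m ℓ)) = LaurentPolynomial.C (e (yv n m ℓ)) := by
  rw [grading_apply, lift_yv]

theorem grading_zv (i : Fin n) (w : ℤ) : grading e i w (e (zv n m ℓ)) =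
    LaurentPolynomial.C (e (zv n m ℓ)) * LaurentPolynomial.T (-(2 * w)) := by
  rw [grading_apply, lift_zv]

theorem grading_tv (i : Fin n) (w : ℤ) :
    grading e i w (e (tv n m ℓ)) = LaurentPolynomial.C (e (tv n m ℓ)) := by
  rw [grading_apply, lift_tv]

/-- The automorphism of the Laurent polynomial ring induced by the torus coaction. -/
noncomputable def gradingLift (i : Fin n) (w : ℤ) : LaurentPolynomial R →ₐ[ℂ] LaurentPolynomial R :=
  laurentLift (grading e i w) (Tu _)

theorem gradingLift_C (i : Fin n) (w : ℤ) (a : R) :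
    gradingLift e i w (LaurentPolynomial.C a) = grading e i w a :=
  laurentLift_C ..

theorem gradingLift_T (i : Fin n) (w k : ℤ) :
    gradingLift e i w (LaurentPolynomial.T k) = LaurentPolynomial.T k := by
  rw [gradingLift, laurentLift_T, val_Tu_zpow]

theorem gradingLift_gradingLift {i : Fin n} {w w' : ℤ} (h : w' + w = 0)
    (f : LaurentPolynomial R) : gradingLift e i w (gradingLift e i w' f) = f := by
  suffices (gradingLift e i w).comp (gradingLift e i w') = AlgHom.id ℂ _ from
    DFunLike.congr_fun this f
  apply laurent_algHom_ext
  · apply equiv_algHom_ext e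
    · intro j
      simp only [AlgHom.comp_apply, laurentC_apply, gradingLift_C, grading_xv, map_mul,
        gradingLift_T, AlgHom.id_apply, mul_assoc, ← LaurentPolynomial.T_add]
      split_ifs
      · rw [add_comm w w', h, LaurentPolynomial.T_zero, mul_one]
      · rw [add_zero, LaurentPolynomial.T_zero, mul_one]
    · simp only [AlgHom.comp_apply, laurentC_apply, gradingLift_C, grading_yv, AlgHom.id_apply]
    · simp only [AlgHom.comp_apply, laurentC_apply, gradingLift_C, grading_zv, map_mul,
        gradingLift_T, AlgHom.id_apply, mul_assoc, ← LaurentPolynomial.T_add]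
      rw [show -(2 * w) + -(2 * w') = 0 by linarith, LaurentPolynomial.T_zero, mul_one]
    · simp only [AlgHom.comp_apply, laurentC_apply, gradingLift_C, grading_tv, AlgHom.id_apply]
  · simp only [AlgHom.comp_apply, gradingLift_T, AlgHom.id_apply]

theorem laurentLift_one_grading (i : Fin n) (w : ℤ) (a : R) :
    laurentLift (AlgHom.id ℂ R) 1 (grading e i w a) = a := by
  suffices (laurentLift (AlgHom.id ℂ R) 1).comp (grading e i w) =
    AlgHom.id ℂ _ from DFunLike.congr_fun this a
  apply equiv_algHom_ext e
  all_goals simp [grading_xv, grading_yv, grading_zv, grading_tv]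

theorem dvd_coeff_grading (i : Fin n) (a : R) :
    (∀ k, k < 0 → e (zv n m ℓ) ∣ (grading e i 1 a).coeff k) ∧
      ∀ k, 0 < k → e (xv n m ℓ i) ∣ (grading e i 1 a).coeff k := by
  have hC (b : R) :
      (∀ k, k < 0 → e (zv n m ℓ) ∣ (LaurentPolynomial.C b).coeff k) ∧
        ∀ k, 0 < k → e (xv n m ℓ i) ∣ (LaurentPolynomial.C b).coeff k := by
    constructor
    · intro k hk
      rw [LaurentPolynomial.C_apply, if_neg (by omega)]
      exact dvd_zero _
    · intro k hk
      rw [LaurentPolynomial.C_apply, if_neg (by omega)]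
      exact dvd_zero _
  induction a using equiv_induction e with
  | hx j =>
    rw [grading_xv]
    split_ifs with h
    · subst h
      constructor
      · intro k hk
        rw [coeff_C_mul_T, if_neg (by omega)]
        exact dvd_zero _
      · intro k hk
        rw [coeff_C_mul_T]
        split_ifs
        · exact dvd_rfl
        · exact dvd_zero _
    · rw [LaurentPolynomial.T_zero, mul_one]
      exact hC _
  | hy => rw [grading_yv]; exact hC _
  | hz =>
    rw [grading_zv]
    constructor
    · intro k hk
      rw [coeff_C_mul_T]
      split_ifs
      · exact dvd_rfl
      · exact dvd_zero _
    · intro k hk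
      rw [coeff_C_mul_T, if_neg (by omega)]
      exact dvd_zero _
  | ht => rw [grading_tv]; exact hC _
  | hC c => rw [AlgHom.commutes]; exact hC _
  | hadd a b ha hb =>
    rw [map_add, AddMonoidAlgebra.coeff_add]
    exact ⟨fun k hk => dvd_add (ha.1 k hk) (hb.1 k hk),
      fun k hk => dvd_add (ha.2 k hk) (hb.2 k hk)⟩
  | hmul a b ha hb =>
    rw [map_mul]
    exact ⟨dvd_coeff_mul (I := fun k => k < 0) (fun i j h => by omega) ha.1 hb.1,
      dvd_coeff_mul (I := fun k => 0 < k) (fun i j h => by omega) ha.2 hb.2⟩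

end Grading

section Rigidity

theorem zv_ne_zero (n : ℕ) {m ℓ : ℕ} (hℓ : 1 ≤ ℓ) (hm : 1 ≤ m) : zv n m ℓ ≠ 0 := by
  intro h
  have h1 := base_relation (n := n) (m := m) hℓ
  rw [h, mul_zero, ← evalY_C, ← evalY_X n hℓ, ← map_pow, ← map_add, eq_comm] at h1
  exact Polynomial.X_pow_add_C_ne_zero hm _
    ((map_eq_zero_iff _ (evalY_injective n hℓ)).1 h1)

theorem xv_ne_zero {n m ℓ : ℕ} (hℓ : 1 ≤ ℓ) (i : Fin n) : xv n m ℓ i ≠ 0 := by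
  rw [← base_xb n m hℓ]
  exact (map_ne_zero_iff _ (base_injective n hℓ)).2 (xb_ne_zero i)

variable {n m ℓ : ℕ} {R : Type*} [CommRing R] [Algebra ℂ R] (e : negKodairaRing n m ℓ ≃ₐ[ℂ] R)

include e

theorem derivation_eq_zero {D : Derivation ℂ R R} (hx : ∀ i, D (e (xv n m ℓ i)) = 0)
    (hy : D (e (yv n m ℓ)) = 0) (hz : D (e (zv n m ℓ)) = 0) (ht : D (e (tv n m ℓ)) = 0) :
    D = 0 := by
  ext a
  induction a using equiv_induction e with
  | hx i => exact hx i
  | hy => exact hy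
  | hz => exact hz
  | ht => exact ht
  | hC c => rw [Derivation.map_algebraMap]; rfl
  | hadd a b ha hb => rw [map_add, ha, hb, map_add]
  | hmul a b ha hb => rw [Derivation.leibniz, ha, hb]; simp

theorem equiv_isDomain (hℓ : 1 ≤ ℓ) (hm : 1 ≤ m) : IsDomain R :=
  have := isDomain n hℓ hm
  e.symm.toMulEquiv.isDomain _

theorem isUnit_equiv_tv (hℓ : 1 ≤ ℓ) : IsUnit (e (tv n m ℓ)) := (isUnit_tv hℓ).map e

theorem equiv_relation_units (hℓ : 1 ≤ ℓ) :
    ∃ τ, IsUnit τ ∧ (∏ i, e (xv n m ℓ i)) ^ 2 * e (zv n m ℓ) = e (yv n m ℓ) ^ m + τ := by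
  have h := equiv_relation e
  rw [← (isUnit_equiv_tv e hℓ).unit_spec] at h
  exact ⟨_, Units.isUnit _, relation_iff_of_units.1 h⟩

theorem IsLND.eq_zero_of_zv_dvd {D : Derivation ℂ R R} (hD : IsLND D) (hm : 2 ≤ m) (hℓ : 1 ≤ ℓ)
    (h : e (zv n m ℓ) ∣ D (e (zv n m ℓ))) : D = 0 := by
  have := equiv_isDomain e hℓ (by omega)
  obtain ⟨τ, hτ, hrel⟩ := equiv_relation_units e hℓ
  have hz0 : e (zv n m ℓ) ≠ 0 := (map_ne_zero_iff _ e.injective).2 (zv_ne_zero n hℓ (by omega))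
  have hx0 (i : Fin n) : e (xv n m ℓ i) ≠ 0 := (map_ne_zero_iff _ e.injective).2 (xv_ne_zero hℓ i)
  have hp0 : ∏ i, e (xv n m ℓ i) ≠ 0 := Finset.prod_ne_zero_iff.2 fun i _ => hx0 i
  obtain ⟨hy, hx⟩ := hD.map_eq_zero_of_relation hm hτ hrel hz0 hp0 h
  refine derivation_eq_zero e (fun i => ?_) hy (hD.map_eq_zero_of_dvd_map h)
    (hD.map_eq_zero_of_isUnit (isUnit_equiv_tv e hℓ))
  rw [← Finset.mul_prod_erase _ _ (Finset.mem_univ i)] at hp0 hx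
  exact hD.map_eq_zero_of_mul hp0 hx

/-- The derivation of the Laurent polynomial ring obtained from a derivation of the coefficients by
twisting with the grading. -/
noncomputable def twistD (i : Fin n) (D : Derivation ℂ R R) :
    Derivation ℂ (LaurentPolynomial R) (LaurentPolynomial R) :=
  conjD (laurentD D) (gradingLift e i 1) (gradingLift e i (-1))
    (gradingLift_gradingLift e (by norm_num))

theorem IsLND.twistD {D : Derivation ℂ R R} (hD : IsLND D) (i : Fin n) : IsLND (twistD e i D) :=
  hD.laurentD.conjD _ _ _ (gradingLift_gradingLift e (by norm_num))

theorem twistD_T (i : Fin n) (D : Derivation ℂ R R) (k : ℤ) :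
    twistD e i D (LaurentPolynomial.T k) = 0 := by
  have := laurentD_C_mul_T D 1 k
  rw [map_one, one_mul, Derivation.map_one_eq_zero, map_zero, zero_mul] at this
  rw [twistD, conjD_apply, gradingLift_T, this, map_zero]

theorem twistD_C (i : Fin n) (D : Derivation ℂ R R) {a : R} {w : ℤ}
    (h : grading e i (-1) a = LaurentPolynomial.C a * LaurentPolynomial.T w) :
    twistD e i D (LaurentPolynomial.C a) = grading e i 1 (D a) * LaurentPolynomial.T w := by
  rw [twistD, conjD_apply, gradingLift_C, h, laurentD_C_mul_T, map_mul, gradingLift_C,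
    gradingLift_T]

theorem componentD_twistD (i : Fin n) (D : Derivation ℂ R R) {a : R} {w : ℤ}
    (h : grading e i (-1) a = LaurentPolynomial.C a * LaurentPolynomial.T w) (k : ℤ) :
    componentD (twistD e i D) k a = (grading e i 1 (D a)).coeff (k - w) := by
  rw [componentD_apply, twistD_C e i D h, coeff_mul_T]

theorem eventually_componentD_eq_zero (Δ : Derivation ℂ (LaurentPolynomial R) (LaurentPolynomial R)) :
    ∀ᶠ j in Filter.atBot, componentD Δ j = 0 := by
  have hx : ∀ᶠ j in Filter.atBot, ∀ i, componentD Δ j (e (xv n m ℓ i)) = 0 :=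
    Filter.eventually_all.2 fun i => eventually_coeff_eq_zero _
  filter_upwards [hx, eventually_coeff_eq_zero (Δ (LaurentPolynomial.C (e (yv n m ℓ)))),
    eventually_coeff_eq_zero (Δ (LaurentPolynomial.C (e (zv n m ℓ)))),
    eventually_coeff_eq_zero (Δ (LaurentPolynomial.C (e (tv n m ℓ))))] with j h1 h2 h3 h4
  exact derivation_eq_zero e h1 h2 h3 h4

theorem IsLND.componentD_twistD_eq_zero {D : Derivation ℂ R R} (hD : IsLND D) (hm : 2 ≤ m)
    (hℓ : 1 ≤ ℓ) (i : Fin n) {k : ℤ} (hk : k < 0) :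
    NegKodaira.componentD (NegKodaira.twistD e i D) k = 0 := by
  by_contra hne
  obtain ⟨b, hb⟩ := Filter.eventually_atBot.1
    (eventually_componentD_eq_zero e (NegKodaira.twistD e i D))
  obtain ⟨l, ⟨hl0, hl⟩, hmin⟩ := Int.exists_least_of_bdd
    (P := fun j => j < 0 ∧ NegKodaira.componentD (NegKodaira.twistD e i D) j ≠ 0)
    ⟨b, fun j hj => le_of_not_ge fun h => hj.2 (hb j h)⟩ ⟨k, hk, hne⟩
  have hLND := (hD.twistD e i).componentD (twistD_T e i D) (k := l) fun j hj => by
    by_contra h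
    exact absurd (hmin j ⟨by omega, h⟩) (by omega)
  refine hl (hLND.eq_zero_of_zv_dvd e hm hℓ ?_)
  rw [componentD_twistD e i D (w := 2) (by rw [grading_zv]; norm_num)]
  exact (dvd_coeff_grading e i _).1 _ (by omega)

theorem IsLND.map_xv_eq_zero {D : Derivation ℂ R R} (hD : IsLND D) (hm : 2 ≤ m) (hℓ : 1 ≤ ℓ)
    (i : Fin n) : D (e (xv n m ℓ i)) = 0 := by
  have := equiv_isDomain e hℓ (by omega)
  refine hD.map_eq_zero_of_dvd_map ?_
  have hsum := laurentLift_one_grading e i 1 (D (e (xv n m ℓ i)))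
  have hdvd (k : ℤ) : e (xv n m ℓ i) ∣ (grading e i 1 (D (e (xv n m ℓ i)))).coeff k := by
    rcases lt_or_ge 0 k with hk | hk
    · exact (dvd_coeff_grading e i _).2 k hk
    · have h0 := DFunLike.congr_fun
        (hD.componentD_twistD_eq_zero e hm hℓ i (show k - 1 < 0 by omega)) (e (xv n m ℓ i))
      rw [componentD_twistD e i D (w := -1) (by rw [grading_xv, if_pos rfl]),
        sub_neg_eq_add, sub_add_cancel, Derivation.zero_apply] at h0
      rw [h0]
      exact dvd_zero _
  have key (f : LaurentPolynomial R) (hf : ∀ k, e (xv n m ℓ i) ∣ f.coeff k) :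
      e (xv n m ℓ i) ∣ laurentLift (AlgHom.id ℂ R) 1 f := by
    rw [show f = ∑ k ∈ f.coeff.support, LaurentPolynomial.C (f.coeff k) * LaurentPolynomial.T k by
      simp_rw [← LaurentPolynomial.single_eq_C_mul_T]
      exact (AddMonoidAlgebra.sum_coeff_single f).symm, map_sum]
    refine Finset.dvd_sum fun k _ => ?_
    rw [map_mul, laurentLift_C]
    exact (hf k).mul_right _
  rw [← hsum]
  exact key _ hdvd

end Rigidity

section Triangular

section

variable {R K : Type*} [CommRing R] [Algebra ℂ R] [Field K] [Algebra ℂ K]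
  (M : R →ₐ[ℂ] Polynomial K) (hM : Function.Injective M) (c : K)
  (h : ∀ a, ∃ b, M b = Polynomial.C c * Polynomial.derivative (M a))

include hM h

theorem exists_isLND : ∃ D : Derivation ℂ R R, IsLND D ∧
    ∀ a, M (D a) = Polynomial.C c * Polynomial.derivative (M a) := by
  choose d hd using h
  let D : Derivation ℂ R R := Derivation.mk'
    { toFun := d
      map_add' := fun a b => hM (by simp only [map_add, hd, mul_add])
      map_smul' := fun r a => hM (by
        rw [hd, map_smul, Polynomial.derivative_smul, RingHom.id_apply, map_smul, hd,
          mul_smul_comm]) }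
    (fun a b => hM (by
      change M (d _) = M (a * d b + b * d a)
      rw [hd, map_mul M, Polynomial.derivative_mul, map_add, map_mul, map_mul, hd, hd]
      ring))
  have hD (a : R) : M (D a) = Polynomial.C c * Polynomial.derivative (M a) := hd a
  have hit (r : ℕ) (a : R) :
      M (D^[r] a) = Polynomial.C c ^ r * Polynomial.derivative^[r] (M a) := by
    induction r with
    | zero => simp
    | succ r ih =>
      rw [Function.iterate_succ_apply', hD, ih, Function.iterate_succ_apply', ← map_pow,
        Polynomial.derivative_C_mul, pow_succ', map_pow, mul_assoc]
  refine ⟨D, fun a => ⟨(M a).natDegree + 1, hM ?_⟩, hD⟩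
  rw [hit, Polynomial.iterate_derivative_eq_zero (Nat.lt_succ_self _), mul_zero, map_zero]

variable (hc : c ≠ 0) {n m ℓ : ℕ} (e : negKodairaRing n m ℓ ≃ₐ[ℂ] R) (hm : 2 ≤ m) (hℓ : 1 ≤ ℓ)

include hc hm hℓ

theorem exists_C_eq_map_xv (i : Fin n) : ∃ d, Polynomial.C d = M (e (xv n m ℓ i)) := by
  have := charZero_of_injective_algebraMap (algebraMap ℂ K).injective
  obtain ⟨D, hD, hMD⟩ := exists_isLND M hM c h
  have h1 := hMD (e (xv n m ℓ i))
  rw [hD.map_xv_eq_zero e hm hℓ, map_zero, eq_comm, mul_eq_zero,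
    or_iff_right (Polynomial.C_ne_zero.2 hc)] at h1
  exact ⟨_, (Polynomial.eq_C_of_natDegree_eq_zero
    (Polynomial.derivative_eq_zero.1 h1)).symm⟩

theorem exists_C_eq_map_base (a : Base n) :
    ∃ d, Polynomial.C d = M (e (base n m hℓ a)) := by
  induction a using LaurentPolynomial.induction_on' with
  | add f g hf hg =>
    obtain ⟨d, hd⟩ := hf
    obtain ⟨d', hd'⟩ := hg
    exact ⟨d + d', by rw [map_add, map_add, map_add, map_add, hd, hd']⟩
  | C_mul_T k a =>
    have hT : IsUnit (M (e (base n m hℓ (LaurentPolynomial.T k)))) :=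
      (((LaurentPolynomial.isUnit_T k).map (base n m hℓ)).map e).map M
    obtain ⟨d, -, hd⟩ := Polynomial.isUnit_iff.1 hT
    have hC : ∃ d, Polynomial.C d = M (e (base n m hℓ (LaurentPolynomial.C a))) := by
      induction a using MvPolynomial.induction_on with
      | C r =>
        refine ⟨algebraMap ℂ K r, ?_⟩
        have : (LaurentPolynomial.C (C r) : Base n) = algebraMap ℂ (Base n) r := rfl
        rw [this, AlgHom.commutes, AlgEquiv.commutes, AlgHom.commutes]
        rfl
      | add f g hf hg =>
        obtain ⟨d, hd⟩ := hf
        obtain ⟨d', hd'⟩ := hg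
        exact ⟨d + d', by rw [map_add, map_add, map_add, map_add, map_add, hd, hd']⟩
      | mul_X f i hf =>
        obtain ⟨d, hd⟩ := hf
        obtain ⟨d', hd'⟩ := exists_C_eq_map_xv M hM c h hc e hm hℓ i
        refine ⟨d * d', ?_⟩
        have : (LaurentPolynomial.C (X i) : Base n) = xb i := rfl
        rw [map_mul, map_mul, map_mul, map_mul, map_mul, hd, hd', this, base_xb]
    obtain ⟨d', hd'⟩ := hC
    exact ⟨d' * d, by rw [map_mul, map_mul, map_mul, map_mul, hd, hd']⟩

theorem natDegree_map_yv {r : R} (hr : M r = Polynomial.X) :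
    (M (e (yv n m ℓ))).natDegree = 1 := by
  let σ : Base n →+* K := Polynomial.constantCoeff.comp
    (((M : R →+* Polynomial K).comp (e : negKodairaRing n m ℓ →+* R)).comp
      (base n m hℓ : Base n →+* negKodairaRing n m ℓ))
  have hσ (a : Base n) : Polynomial.C (σ a) = M (e (base n m hℓ a)) := by
    obtain ⟨d, hd⟩ := exists_C_eq_map_base M hM c h hc e hm hℓ a
    change Polynomial.C (Polynomial.constantCoeff (M (e (base n m hℓ a)))) = _
    rw [← hd, Polynomial.constantCoeff_apply, Polynomial.coeff_C_zero]
  have hev (p : Polynomial (Base n)) :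
      M (e (evalY n m hℓ p)) = (p.map σ).comp (M (e (yv n m ℓ))) := by
    induction p using Polynomial.induction_on' with
    | add p q hp hq => rw [map_add, map_add, map_add, hp, hq, Polynomial.map_add,
        Polynomial.add_comp]
    | monomial k b =>
      rw [← Polynomial.C_mul_X_pow_eq_monomial, map_mul, map_pow, evalY_C, evalY_X, map_mul,
        map_pow, map_mul, map_pow, ← hσ]
      simp
  obtain ⟨N, p, hp⟩ := exists_pow_mul_eq_evalY n hℓ (e.symm r)
  have h1 := congrArg (fun a => M (e a)) hp
  have h0 : σ (pb n) ≠ 0 := by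
    intro h0
    have h2 := hσ (pb n)
    rw [h0, map_zero, eq_comm, map_eq_zero_iff M hM, map_eq_zero_iff e e.injective,
      map_eq_zero_iff _ (base_injective n hℓ)] at h2
    exact Finset.prod_ne_zero_iff.2 (fun i _ => xb_ne_zero i) h2
  simp only [hev, map_mul, map_pow, ← hσ, AlgEquiv.apply_symm_apply, hr] at h1
  rw [← map_pow] at h1
  have h2 := congrArg Polynomial.natDegree h1
  rw [Polynomial.natDegree_C_mul_X _ (pow_ne_zero _ h0), Polynomial.natDegree_comp] at h2
  exact Nat.eq_one_of_mul_eq_one_left h2.symm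

end

theorem exists_model_eq_derivative {n m ℓ : ℕ} (hℓ : 1 ≤ ℓ) {K : Type*} [Field K] [Algebra ℂ K]
    (κ : Base n →ₐ[ℂ] K) (hκ : Function.Injective κ) (a : negKodairaRing n m ℓ) :
    ∃ b : negKodairaRing n m ℓ, model n m κ hκ b =
      Polynomial.C (κ (pb n ^ 2)) * Polynomial.derivative (model n m κ hκ a) := by
  have hbase (f : Base n) : ∃ b : negKodairaRing n m ℓ, model n m κ hκ b =
      Polynomial.C (κ (pb n ^ 2)) * Polynomial.derivative (model n m κ hκ (base n m hℓ f)) :=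
    ⟨0, by rw [model_base, Polynomial.derivative_C, mul_zero, map_zero]⟩
  induction a using induction with
  | hx i => rw [← base_xb n m hℓ]; exact hbase _
  | hy => exact ⟨base n m hℓ (pb n ^ 2), by
      rw [model_base, model_yv, Polynomial.derivative_X, mul_one]⟩
  | hz =>
    refine ⟨m * yv n m ℓ ^ (m - 1), ?_⟩
    have h0 : κ (pb n ^ 2) * (∏ i, κ (xb i))⁻¹ ^ 2 = 1 := by
      rw [map_pow, pb, map_prod, ← mul_pow, mul_inv_cancel₀, one_pow]
      exact Finset.prod_ne_zero_iff.2 fun i _ => map_xb_ne_zero n κ hκ i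
    rw [model_zv, Polynomial.derivative_C_mul, ← mul_assoc, ← map_mul, h0, map_one, one_mul,
      Polynomial.derivative_add, Polynomial.derivative_C, add_zero, Polynomial.derivative_X_pow,
      map_mul, map_pow, model_yv, map_natCast, map_natCast]
  | ht => rw [← base_T_one n m hℓ]; exact hbase _
  | hC r => rw [← (base n m hℓ).commutes]; exact hbase _
  | hadd a b ha hb =>
    obtain ⟨a', ha⟩ := ha
    obtain ⟨b', hb⟩ := hb
    exact ⟨a' + b', by rw [map_add, map_add, Polynomial.derivative_add, ha, hb, mul_add]⟩
  | hmul a b ha hb =>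
    obtain ⟨a', ha⟩ := ha
    obtain ⟨b', hb⟩ := hb
    refine ⟨a' * b + a * b', ?_⟩
    rw [map_add, map_mul, map_mul, map_mul, Polynomial.derivative_mul, ha, hb]
    ring

variable {n m ℓ ℓ' : ℕ} (e : negKodairaRing n m ℓ ≃ₐ[ℂ] negKodairaRing n m ℓ')
    (hm : 2 ≤ m) (hℓ : 1 ≤ ℓ) (hℓ' : 1 ≤ ℓ')

include hm

theorem exists_base_eq_map_base (a : Base n) : ∃ b, e (base n m hℓ a) = base n m hℓ' b := by
  let κ := IsScalarTower.toAlgHom ℂ (Base n) (FractionRing (Base n))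
  have hκ : Function.Injective κ := IsFractionRing.injective _ _
  obtain ⟨d, hd⟩ := exists_C_eq_map_base (model n m κ hκ) (model_injective n hℓ' κ hκ (by omega))
    _ (exists_model_eq_derivative hℓ' κ hκ) ((map_ne_zero_iff κ hκ).2 (pow_ne_zero 2
      (Finset.prod_ne_zero_iff.2 fun i _ => xb_ne_zero i))) e hm hℓ a
  exact exists_base_of_natDegree_eq_zero n hℓ' κ hκ hm (by rw [← hd, Polynomial.natDegree_C])

theorem exists_base_add_eq_map_yv (hℓ : 1 ≤ ℓ) :
    ∃ f g, e (yv n m ℓ) = base n m hℓ' f + base n m hℓ' g * yv n m ℓ' := by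
  let κ := IsScalarTower.toAlgHom ℂ (Base n) (FractionRing (Base n))
  have hκ : Function.Injective κ := IsFractionRing.injective _ _
  have h := natDegree_map_yv (model n m κ hκ) (model_injective n hℓ' κ hκ (by omega))
    _ (exists_model_eq_derivative hℓ' κ hκ) ((map_ne_zero_iff κ hκ).2 (pow_ne_zero 2
      (Finset.prod_ne_zero_iff.2 fun i _ => xb_ne_zero i))) e hm hℓ (model_yv n m κ hκ)
  exact exists_base_add_of_natDegree_le n hℓ' κ hκ hm h.le

end Triangular

section LaurentUnits

theorem exists_eq_smul_T_of_isUnit {S : Type*} [CommRing S] [IsDomain S] [Algebra ℂ S]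
    (hS : ∀ u : S, IsUnit u → ∃ c : ℂ, algebraMap ℂ S c = u) {P : LaurentPolynomial S}
    (hP : IsUnit P) :
    ∃ c : ℂ, c ≠ 0 ∧ ∃ k : ℤ, P = c • (LaurentPolynomial.T k : LaurentPolynomial S) := by
  obtain ⟨Q, hQ⟩ := hP.exists_right_inv
  obtain ⟨i, p, hp⟩ := LaurentPolynomial.exists_T_pow P
  obtain ⟨j, q, hq⟩ := LaurentPolynomial.exists_T_pow Q
  have hpq : p * q = Polynomial.X ^ (i + j) := by
    apply Polynomial.toLaurent_injective
    rw [map_mul, hp, hq, mul_mul_mul_comm, hQ, one_mul, Polynomial.toLaurent_X_pow,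
      ← LaurentPolynomial.T_add, Nat.cast_add]
  obtain ⟨k, -, hk⟩ := (dvd_prime_pow Polynomial.prime_X (i + j)).1 ⟨q, hpq.symm⟩
  obtain ⟨u, hu⟩ := hk.symm
  obtain ⟨r, hr, hru⟩ := Polynomial.isUnit_iff.1 u.isUnit
  obtain ⟨c, rfl⟩ := hS r hr
  refine ⟨c, ?_, k - i, ?_⟩
  · rintro rfl
    rw [map_zero] at hr
    exact not_isUnit_zero hr
  · have h1 : P = P * LaurentPolynomial.T i * LaurentPolynomial.T (-i) := by
      rw [mul_assoc, ← LaurentPolynomial.T_add, add_neg_cancel, LaurentPolynomial.T_zero, mul_one]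
    rw [h1, ← hp, ← hu, ← hru, map_mul, Polynomial.toLaurent_X_pow, Polynomial.toLaurent_C,
      algebraMap_mul_eq, sub_eq_add_neg, LaurentPolynomial.T_add]
    ring

theorem exists_eq_smul_T_of_isUnit_base {n : ℕ} {P : Base n} (hP : IsUnit P) :
    ∃ c : ℂ, c ≠ 0 ∧ ∃ k : ℤ, P = c • (LaurentPolynomial.T k : Base n) :=
  exists_eq_smul_T_of_isUnit (fun _ hu =>
    let ⟨c, _, hc⟩ := MvPolynomial.isUnit_iff_eq_C_of_isReduced.1 hu
    ⟨c, hc.symm⟩) hP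

theorem coeff_smul_T {S : Type*} [CommRing S] [Algebra ℂ S] (c : ℂ) (k i : ℤ) :
    (c • (LaurentPolynomial.T k : LaurentPolynomial S)).coeff i =
      if i = k then algebraMap ℂ S c else 0 := by
  rw [algebraMap_mul_eq, coeff_C_mul_T]

theorem mul_zpow_zpow {S : Type*} [CommRing S] (a b : Sˣ) (i k : ℤ) :
    (a * b ^ i) ^ k = a ^ k * b ^ (i * k) := by
  rw [mul_zpow, zpow_mul]

theorem exists_map_T {n : ℕ} {A A' : Type*} [CommRing A] [CommRing A'] [Algebra ℂ A] [Algebra ℂ A']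
    (β : Base n →ₐ[ℂ] A) (β' : Base n →ₐ[ℂ] A') (hβ' : Function.Injective β') (e : A ≃ₐ[ℂ] A')
    (he : ∀ a, ∃ b, e (β a) = β' b) :
    ∃ (c : ℂˣ) (κ : ℤ), ∀ k : ℤ, e (β (LaurentPolynomial.T k)) =
      β' (((c ^ k : ℂˣ) : ℂ) • LaurentPolynomial.T (κ * k)) := by
  obtain ⟨τ, hτ⟩ := he (LaurentPolynomial.T 1)
  obtain ⟨τ', hτ'⟩ := he (LaurentPolynomial.T (-1))
  have hu : IsUnit τ := by
    refine IsUnit.of_mul_eq_one τ' (hβ' ?_)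
    rw [map_mul, ← hτ, ← hτ', ← map_mul, ← map_mul, ← LaurentPolynomial.T_add, add_neg_cancel,
      LaurentPolynomial.T_zero, map_one, map_one, map_one]
  obtain ⟨c, hc, κ, rfl⟩ := exists_eq_smul_T_of_isUnit_base hu
  refine ⟨Units.mk0 c hc, κ, fun k => ?_⟩
  have h1 : unitsMap (e.toAlgHom.comp β) (Tu _) =
      unitsMap β' (unitsMap (Algebra.ofId ℂ (Base n)) (Units.mk0 c hc) * Tu _ ^ κ) := by
    refine Units.ext (hτ.trans ?_)
    rw [val_unitsMap, Units.val_mul, val_unitsMap, val_Tu_zpow, Algebra.smul_def]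
    rfl
  have h2 := map_val_zpow (e.toAlgHom.comp β) (Tu _) k
  rw [h1, ← map_val_zpow, val_Tu_zpow] at h2
  refine h2.trans (congrArg β' ((congrArg Units.val (mul_zpow_zpow _ _ κ k)).trans ?_))
  rw [Units.val_mul, ← map_val_zpow, val_Tu_zpow, Algebra.smul_def]
  rfl

theorem exponent_mul_eq_one {n : ℕ} {A A' : Type*} [CommRing A] [CommRing A'] [Algebra ℂ A]
    [Algebra ℂ A'] (β : Base n →ₐ[ℂ] A) (β' : Base n →ₐ[ℂ] A') (hβ' : Function.Injective β')
    (e : A ≃ₐ[ℂ] A') {c c' : ℂˣ} {κ κ' : ℤ}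
    (h : ∀ k : ℤ, e (β (LaurentPolynomial.T k)) =
      β' (((c ^ k : ℂˣ) : ℂ) • LaurentPolynomial.T (κ * k)))
    (h' : ∀ k : ℤ, e.symm (β' (LaurentPolynomial.T k)) =
      β (((c' ^ k : ℂˣ) : ℂ) • LaurentPolynomial.T (κ' * k))) : κ * κ' = 1 := by
  have h1 := congrArg e (h' 1)
  rw [e.apply_symm_apply, map_smul, map_smul, h, ← map_smul, smul_smul, mul_one] at h1
  have h2 := congrArg (fun P : Base n => P.coeff 1) (hβ' h1)
  rw [coeff_smul_T, LaurentPolynomial.T_apply, if_pos rfl] at h2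
  by_contra hne
  rw [if_neg (Ne.symm hne)] at h2
  exact one_ne_zero h2

end LaurentUnits

section Divisibility

theorem base_add_injective {n m ℓ : ℕ} (hℓ : 1 ≤ ℓ) {f g f' g' : Base n}
    (h : base n m hℓ f + base n m hℓ g * yv n m ℓ = base n m hℓ f' + base n m hℓ g' * yv n m ℓ) :
    g = g' := by
  simp only [← evalY_C, ← evalY_X n hℓ, ← map_mul, ← map_add] at h
  simpa using congrArg (fun p : Polynomial (Base n) => p.coeff 1) (evalY_injective n hℓ h)

theorem dvd_pb_pow {n m ℓ : ℕ} (hℓ : 1 ≤ ℓ) (hm : 1 ≤ m) {Q f g u : Base n} {w : negKodairaRing n m ℓ}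
    (hg : IsUnit g) (h : base n m hℓ Q ^ 2 * w =
      (base n m hℓ f + base n m hℓ g * yv n m ℓ) ^ m + base n m hℓ u) : ∃ N, Q ∣ pb n ^ N := by
  obtain ⟨N, p, hp⟩ := exists_pow_mul_eq_evalY n hℓ w
  have h1 : evalY n m hℓ (Polynomial.C (Q ^ 2) * p) = evalY n m hℓ (Polynomial.C (pb n ^ N) *
      ((Polynomial.C f + Polynomial.C g * Polynomial.X) ^ m + Polynomial.C u)) := by
    simp only [map_mul, map_add, map_pow, evalY_C, evalY_X, ← hp, ← h]
    ring
  have h2 := congrArg (fun q : Polynomial (Base n) => q.coeff m) (evalY_injective n hℓ h1)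
  have h3 : ((Polynomial.C f + Polynomial.C g * Polynomial.X) ^ m).coeff m = g ^ m := by
    have := Polynomial.coeff_pow_of_natDegree_le (m := m) (n := 1)
      (p := Polynomial.C f + Polynomial.C g * Polynomial.X) (by compute_degree)
    rw [mul_one] at this
    rw [this]
    simp
  have h4 : (Polynomial.C u).coeff m = 0 := Polynomial.coeff_C_of_ne_zero (by omega)
  simp only [Polynomial.coeff_C_mul, Polynomial.coeff_add, h3, h4, add_zero] at h2
  exact ⟨N, (hg.pow m).dvd_mul_right.1 (h2 ▸ (dvd_pow_self Q two_ne_zero).mul_right _)⟩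

theorem isUnit_leading_coeff {n m ℓ ℓ' : ℕ} {e : negKodairaRing n m ℓ ≃ₐ[ℂ] negKodairaRing n m ℓ'}
    (hm : 2 ≤ m) (hℓ : 1 ≤ ℓ) (hℓ' : 1 ≤ ℓ') {f g : Base n}
    (h : e (yv n m ℓ) = base n m hℓ' f + base n m hℓ' g * yv n m ℓ') : IsUnit g := by
  obtain ⟨f₂, g₂, h₂⟩ := exists_base_add_eq_map_yv e.symm hm hℓ hℓ'
  obtain ⟨f₃, h₃⟩ := exists_base_eq_map_base e hm hℓ hℓ' f₂
  obtain ⟨g₃, hg₃⟩ := exists_base_eq_map_base e hm hℓ hℓ' g₂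
  have h₄ := congrArg e h₂
  rw [e.apply_symm_apply, map_add, map_mul, h₃, hg₃, h] at h₄
  refine IsUnit.of_mul_eq_one g₃ (base_add_injective (m := m) hℓ' (f := f₃ + g₃ * f) (f' := 0) ?_)
  rw [map_zero, map_one, zero_add, one_mul]
  refine Eq.trans ?_ h₄.symm
  rw [map_add, map_mul, map_mul]
  ring

theorem base_pb_dvd_map_pow {n m ℓ ℓ' : ℕ}
    (e : negKodairaRing n m ℓ ≃ₐ[ℂ] negKodairaRing n m ℓ')
    (hm : 2 ≤ m) (hℓ : 1 ≤ ℓ) (hℓ' : 1 ≤ ℓ') :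
    ∃ N, base n m hℓ' (pb n) ∣ e (base n m hℓ (pb n)) ^ N := by
  obtain ⟨Q, hQ⟩ := exists_base_eq_map_base e.symm hm hℓ' hℓ (pb n)
  obtain ⟨u, hu⟩ := exists_base_eq_map_base e.symm hm hℓ' hℓ (LaurentPolynomial.T (-ℓ'))
  obtain ⟨f, g, hy⟩ := exists_base_add_eq_map_yv e.symm hm hℓ hℓ'
  have h1 := congrArg e.symm (base_relation (n := n) (m := m) hℓ')
  rw [map_mul, map_pow, map_pow, map_add, map_pow, hQ, hu, hy] at h1
  obtain ⟨N, hN⟩ := dvd_pb_pow hℓ (by omega) (isUnit_leading_coeff hm hℓ' hℓ hy) h1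
  refine ⟨N, ?_⟩
  have h2 := map_dvd e (map_dvd (base n m hℓ) hN)
  rwa [← hQ, e.apply_symm_apply, map_pow, map_pow] at h2

end Divisibility

section Specialization

variable {n m ℓ : ℕ}

theorem specialization_relation (n : ℕ) {ε : ℂ} (hε : ε ^ m = -1) :
    (LaurentPolynomial.T m : LaurentPolynomial ℂ) ^ ℓ * ((∏ _i : Fin n, 0) ^ 2 * 0 -
      (ε • (LaurentPolynomial.T (-ℓ) : LaurentPolynomial ℂ)) ^ m) = 1 := by
  rw [mul_zero, zero_sub, smul_pow, hε, neg_one_smul, neg_neg, LaurentPolynomial.T_pow,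
    LaurentPolynomial.T_pow, ← LaurentPolynomial.T_add, ← LaurentPolynomial.T_zero]
  congr 1
  ring

/-- The restriction to an orbit of the torus in the locus where the `xᵢ` and `z` vanish. -/
noncomputable def specialization {ε : ℂ} (hε : ε ^ m = -1) :
    negKodairaRing n m ℓ →ₐ[ℂ] LaurentPolynomial ℂ :=
  lift _ _ _ _ (specialization_relation n hε)

variable {ε : ℂ} (hε : ε ^ m = -1) (hℓ : 1 ≤ ℓ)

theorem specialization_yv : specialization hε (yv n m ℓ) = ε • LaurentPolynomial.T (-ℓ) :=
  lift_yv ..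

theorem specialization_base_pb (hn : 1 ≤ n) : specialization hε (base n m hℓ (pb n)) = 0 := by
  rw [base_pb, map_prod]
  exact Finset.prod_eq_zero (Finset.mem_univ ⟨0, hn⟩) (lift_xv ..)

theorem specialization_base_T (k : ℤ) :
    specialization hε (base n m hℓ (LaurentPolynomial.T k)) = LaurentPolynomial.T (m * k) := by
  have h : unitsMap (specialization hε) (tu n m hℓ) = Tu ℂ ^ (m : ℤ) := by
    refine Units.ext ((lift_tv _ _ _ _ (specialization_relation n hε)).trans ?_)
    rw [val_Tu_zpow]
  rw [base_T, map_val_zpow, h, ← zpow_mul, val_Tu_zpow]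

theorem coeff_specialization_base (f : Base n) {k : ℤ} (hk : ¬ (m : ℤ) ∣ k) :
    (specialization hε (base n m hℓ f)).coeff k = 0 := by
  induction f using LaurentPolynomial.induction_on' with
  | add f g hf hg =>
    rw [map_add, map_add, AddMonoidAlgebra.coeff_add, Finsupp.add_apply, hf, hg, add_zero]
  | C_mul_T j a =>
    have hC : specialization hε (base n m hℓ (LaurentPolynomial.C a)) =
        LaurentPolynomial.C (constantCoeff a) := by
      have h : ((specialization hε).comp (base n m hℓ)).comp (laurentC _) =
          aeval (fun _ => (0 : LaurentPolynomial ℂ)) := by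
        apply MvPolynomial.algHom_ext
        intro i
        rw [aeval_X]
        change specialization hε (base n m hℓ (xb i)) = 0
        rw [base_xb]
        exact lift_xv ..
      exact (DFunLike.congr_fun h a).trans (aeval_zero' a)
    rw [map_mul, map_mul, hC, specialization_base_T, coeff_C_mul_T, if_neg]
    rintro rfl
    exact hk (dvd_mul_right _ _)

end Specialization

theorem exponent_eq_of_pow_eq {m : ℕ} (hm : 1 ≤ m) {V : LaurentPolynomial ℂ} {d : ℂ} (hd : d ≠ 0)
    {j k : ℤ} (h : V ^ m = d • LaurentPolynomial.T j) (hk : V.coeff k ≠ 0) : m * k = j := by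
  have hV : IsUnit V := by
    rw [← isUnit_pow_iff (n := m) (by omega), h, algebraMap_mul_eq]
    exact ((IsUnit.mk0 d hd).map LaurentPolynomial.C).mul (LaurentPolynomial.isUnit_T j)
  obtain ⟨c, hc, e, rfl⟩ := exists_eq_smul_T_of_isUnit (fun u _ => ⟨u, rfl⟩) hV
  have hke : k = e := by
    by_contra hne
    rw [coeff_smul_T, if_neg hne] at hk
    exact hk rfl
  subst hke
  rw [smul_pow, LaurentPolynomial.T_pow] at h
  have h1 := congrArg (fun P : LaurentPolynomial ℂ => P.coeff (m * k)) h
  simp only [coeff_smul_T, if_pos] at h1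
  by_contra hne
  rw [if_neg hne] at h1
  exact pow_ne_zero m hc h1

theorem modEq_of_algEquiv {n m ℓ ℓ' : ℕ} (hn : 1 ≤ n) (hm : 2 ≤ m) (hℓ : 1 ≤ ℓ) (hℓ' : 1 ≤ ℓ')
    (hcop' : Nat.gcd ℓ' m = 1) (e : negKodairaRing n m ℓ ≃ₐ[ℂ] negKodairaRing n m ℓ') :
    (ℓ' : ℤ) ≡ ℓ [ZMOD m] ∨ (ℓ' : ℤ) ≡ -ℓ [ZMOD m] := by
  obtain ⟨ε, hε⟩ := IsAlgClosed.exists_pow_nat_eq (-1 : ℂ) (n := m) (by omega)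
  have hε0 : ε ≠ 0 := by
    rintro rfl
    rw [zero_pow (by omega)] at hε
    norm_num at hε
  obtain ⟨c, κ, hκ⟩ := exists_map_T (base n m hℓ) (base n m hℓ') (base_injective n hℓ') e
    (exists_base_eq_map_base e hm hℓ hℓ')
  obtain ⟨c', κ', hκ'⟩ := exists_map_T (base n m hℓ') (base n m hℓ) (base_injective n hℓ) e.symm
    (exists_base_eq_map_base e.symm hm hℓ' hℓ)
  have hκκ' := exponent_mul_eq_one (base n m hℓ) (base n m hℓ') (base_injective n hℓ') e hκ hκ'
  obtain ⟨f, g, hy⟩ := exists_base_add_eq_map_yv e hm hℓ' hℓ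
  obtain ⟨b, hb, k, rfl⟩ := exists_eq_smul_T_of_isUnit_base (isUnit_leading_coeff hm hℓ hℓ' hy)
  let χ := specialization (n := n) (ℓ := ℓ') hε
  have hχX : χ (e (base n m hℓ (pb n))) = 0 := by
    obtain ⟨N, hN⟩ := base_pb_dvd_map_pow e hm hℓ hℓ'
    have h1 := map_dvd χ hN
    rw [specialization_base_pb hε hℓ' hn, zero_dvd_iff, map_pow] at h1
    exact eq_zero_of_pow_eq_zero h1
  have hpow : χ (e (yv n m ℓ)) ^ m =
      (-((c ^ (-ℓ : ℤ) : ℂˣ) : ℂ)) • LaurentPolynomial.T (m * (κ * (-ℓ))) := by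
    have h1 := congrArg (fun a => χ (e a)) (base_relation (n := n) (m := m) hℓ)
    simp only [map_mul, map_add, map_pow, hχX, hκ, map_smul] at h1
    rw [specialization_base_T] at h1
    rw [neg_smul, eq_neg_iff_add_eq_zero, ← h1]
    ring
  have hdvd : ¬ (m : ℤ) ∣ m * k - ℓ' := by
    intro h
    have h1 : m ∣ ℓ' := by
      rw [← Int.natCast_dvd_natCast]
      simpa using (dvd_sub_right (dvd_mul_right (m : ℤ) k)).1 h
    have := Nat.dvd_gcd h1 dvd_rfl
    rw [hcop', Nat.dvd_one] at this
    omega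
  have hcoeff : (χ (e (yv n m ℓ))).coeff (m * k - ℓ') ≠ 0 := by
    have h1 : χ (base n m hℓ' (b • LaurentPolynomial.T k) * yv n m ℓ') =
        (b * ε) • LaurentPolynomial.T (m * k - ℓ') := by
      rw [map_mul, specialization_yv, map_smul, map_smul, specialization_base_T,
        smul_mul_smul_comm, ← LaurentPolynomial.T_add, sub_eq_add_neg]
    rw [hy, map_add, h1, AddMonoidAlgebra.coeff_add, Finsupp.add_apply,
      coeff_specialization_base hε hℓ' f hdvd, coeff_smul_T, if_pos rfl, zero_add]
    exact mul_ne_zero hb hε0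
  have hkey := exponent_eq_of_pow_eq (by omega) (neg_ne_zero.2 (Units.ne_zero _)) hpow hcoeff
  have hkey' : m * k - ℓ' = κ * (-ℓ : ℤ) := mul_left_cancel₀ (by positivity) hkey
  rcases Int.isUnit_iff.1 (IsUnit.of_mul_eq_one κ' hκκ') with rfl | rfl
  · exact Or.inl (Int.modEq_iff_dvd.2 ⟨-k, by linarith⟩)
  · exact Or.inr (Int.modEq_iff_dvd.2 ⟨-k, by linarith⟩)

end NegKodaira

/-- **Main Theorem.** Let `n ≥ 1`, `m ≥ 2`, and `ℓ, ℓ' ≥ 1` both coprime with `m` with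
`ℓ'` congruent neither to `ℓ` nor to `-ℓ` modulo `m`.  Then the hypersurfaces
`X_{n,m,ℓ} = {t^ℓ(x₁²⋯xₙ²·z − y^m) = 1}` and `X_{n,m,ℓ'} = {t^ℓ'(x₁²⋯xₙ²·z − y^m) = 1}`
are not isomorphic, but have isomorphic `ℂ*`-cylinders: the `ℂ`-algebras `R_{n,m,ℓ}`
and `R_{n,m,ℓ'}` are not isomorphic, but `R_{n,m,ℓ}[u,u⁻¹] ≅ R_{n,m,ℓ'}[u,u⁻¹]`. -/
theorem negKodaira_laurent_cancellation_fails (n m ℓ ℓ' : ℕ)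
    (hn : 1 ≤ n) (hm : 2 ≤ m) (hℓ : 1 ≤ ℓ) (hℓ' : 1 ≤ ℓ')
    (hcop : Nat.gcd ℓ m = 1) (hcop' : Nat.gcd ℓ' m = 1)
    (h1 : ¬ ((ℓ' : ℤ) ≡ (ℓ : ℤ) [ZMOD m]))
    (h2 : ¬ ((ℓ' : ℤ) ≡ -(ℓ : ℤ) [ZMOD m])) :
    (¬ Nonempty (negKodairaRing n m ℓ ≃ₐ[ℂ] negKodairaRing n m ℓ')) ∧
    Nonempty (LaurentPolynomial (negKodairaRing n m ℓ) ≃ₐ[ℂ]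
      LaurentPolynomial (negKodairaRing n m ℓ')) := by
  refine ⟨fun ⟨e⟩ => ?_, NegKodaira.nonempty_laurent_algEquiv hℓ hℓ' hcop hcop'⟩
  exact (NegKodaira.modEq_of_algEquiv hn hm hℓ hℓ' hcop' e).elim h1 h2
end
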